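/- arXiv:2502.13309 — 5 statements merged into one kernel-verified Lean document; each statement's English description precedes it below -/
import Mathlib

section
/- The number of non-crossing permutations of the multiset {1,1,2,2,...,n,n} (sequences in which every value of [n] appears exactly twice with no indices i<j<k<l satisfying π_i=π_k, π_j=π_l, π_i≠π_j) equals n! times the n-th Catalan number C_n = (1/(n+1))·binom(2n,n). -/
/-- A permutation of the multiset {1,1,2,2,...,n,n}, encoded as a function
`Fin (2*n) → Fin n` where the value `v : Fin n` represents `v+1`:
every value appears exactly twice. -/
def IsMultisetPerm {n : ℕ} (π : Fin (2*n) → Fin n) : Prop :=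
  ∀ v : Fin n, (Finset.univ.filter fun i => π i = v).card = 2

/-- Non-nesting: no indices i<j<k<l with π_i=π_l, π_j=π_k, π_i≠π_j. -/
def NonNesting {n : ℕ} (π : Fin (2*n) → Fin n) : Prop :=
  ¬ ∃ i j k l : Fin (2*n), i < j ∧ j < k ∧ k < l ∧
      π i = π l ∧ π j = π k ∧ π i ≠ π j

/-- Non-crossing: no indices i<j<k<l with π_i=π_k, π_j=π_l, π_i≠π_j. -/
def NonCrossing {n : ℕ} (π : Fin (2*n) → Fin n) : Prop :=
  ¬ ∃ i j k l : Fin (2*n), i < j ∧ j < k ∧ k < l ∧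
      π i = π k ∧ π j = π l ∧ π i ≠ π j

/-- Avoiding the pattern 231: no i<j<k with π_k < π_i < π_j. -/
def Avoids231 {n : ℕ} (π : Fin (2*n) → Fin n) : Prop :=
  ¬ ∃ i j k : Fin (2*n), i < j ∧ j < k ∧ π k < π i ∧ π i < π j

/-- Avoiding 122: no i<j<k with π_i < π_j = π_k. -/
def Avoids122 {n : ℕ} (π : Fin (2*n) → Fin n) : Prop :=
  ¬ ∃ i j k : Fin (2*n), i < j ∧ j < k ∧ π i < π j ∧ π j = π k

/-- The first entry is the value 1 (encoded as `0 : Fin n`). -/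
def FirstIsOne {n : ℕ} (π : Fin (2*n) → Fin n) : Prop :=
  ∃ h : 0 < n, π ⟨0, by omega⟩ = ⟨0, h⟩

/-- The last entry is the value n (encoded as `n-1 : Fin n`). -/
def LastIsMax {n : ℕ} (π : Fin (2*n) → Fin n) : Prop :=
  ∃ h : 0 < n, π ⟨2*n - 1, by omega⟩ = ⟨n - 1, by omega⟩

/-- Non-crossing lists: no alternating sublist `x y x y` with `x ≠ y`. -/
def NCList {α : Type*} (l : List α) : Prop :=
  ∀ x y : α, x ≠ y → ¬ List.Sublist [x, y, x, y] l

theorem NCList.sublist {α : Type*} {l l' : List α} (h : NCList l) (hs : List.Sublist l' l) :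
    NCList l' := fun x y hxy h' => h x y hxy (h'.trans hs)

open Classical in
/-- Non-crossing words using each letter of `S` exactly twice. -/
noncomputable def ncWords {α : Type*} (S : Finset α) : Finset (List α) :=
  (S.val + S.val).lists.toFinset.filter NCList

theorem mem_ncWords {α : Type*} [DecidableEq α] {S : Finset α} {l : List α} :
    l ∈ ncWords S ↔ (∀ x, l.count x = if x ∈ S then 2 else 0) ∧ NCList l := by
  unfold ncWords
  simp only [Finset.mem_filter, Multiset.mem_toFinset, Multiset.mem_lists_iff]
  refine and_congr ?_ Iff.rfl
  change S.val + S.val = (l : Multiset α) ↔ _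
  rw [Multiset.ext]
  refine forall_congr' fun x => ?_
  have h1 : Multiset.count x S.val = if x ∈ S then 1 else 0 := by
    rw [Multiset.count_eq_of_nodup S.nodup]; rfl
  simp only [Multiset.count_add, h1, Multiset.quot_mk_to_coe, Multiset.coe_count]
  split_ifs <;> exact eq_comm

theorem mem_of_ncWords {α : Type*} [DecidableEq α] {S : Finset α} {l : List α}
    (h : l ∈ ncWords S) (x : α) : x ∈ l ↔ x ∈ S := by
  have := (mem_ncWords.1 h).1 x
  rw [← List.count_pos_iff, this]
  split_ifs with hx <;> simp [hx]

theorem ncList_join {α : Type*} {a : α} {l₁ l₂ : List α} (h₁ : NCList l₁) (h₂ : NCList l₂)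
    (ha₁ : a ∉ l₁) (ha₂ : a ∉ l₂) (hd : ∀ x ∈ l₁, x ∉ l₂) : NCList (a :: (l₁ ++ a :: l₂)) := by
  intro x y hxy hs
  have key : ∀ z w : α, z ≠ a → List.Sublist [z, w] (a :: l₂) → List.Sublist [z, w] l₂ := by
    intro z w hz h
    cases h with
    | cons _ h => exact h
    | cons_cons _ h => exact absurd rfl hz
  have tl : ∀ p q : List α, p ++ q = [x, y, x, y] → List.Sublist p l₁ →
      List.Sublist q (a :: l₂) → x ≠ a → False := by
    intro p q hpq hp hq hxa
    match p, hpq with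
    | [], hpq =>
      simp only [List.nil_append] at hpq
      subst hpq
      cases hq with
      | cons _ h => exact h₂ x y hxy h
      | cons_cons _ h => exact hxa rfl
    | b :: p', hpq =>
      simp only [List.cons_append, List.cons.injEq] at hpq
      obtain ⟨rfl, hpq⟩ := hpq
      have hx1 : b ∈ l₁ := hp.subset (by simp)
      match p', hpq with
      | [], hpq =>
        simp only [List.nil_append] at hpq
        subst hpq
        have : b ∈ a :: l₂ := hq.subset (by simp)
        grind
      | [_], hpq =>
        have : b ∈ a :: l₂ := hq.subset (by grind)
        grind
      | [c, d], hpq =>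
        have h1 : c ∈ l₁ := hp.subset (by simp)
        have : c ∈ a :: l₂ := hq.subset (by grind)
        grind
      | [c, d, e], hpq =>
        simp only [List.cons_append, List.nil_append, List.cons.injEq] at hpq
        obtain ⟨rfl, rfl, rfl, -⟩ := hpq
        exact h₁ _ _ hxy hp
      | _ :: _ :: _ :: _ :: _, hpq => simp at hpq
  cases hs with
  | cons _ h =>
    obtain ⟨p, q, hpq, hp, hq⟩ := List.sublist_append_iff.1 h
    by_cases hxa : x = a
    · subst hxa
      match p, hpq with
      | [], hpq =>
        simp only [List.nil_append] at hpq
        subst hpq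
        cases hq with
        | cons _ h => exact ha₂ (h.subset (by simp))
        | cons_cons _ h => exact ha₂ (h.subset (by simp))
      | b :: p', hpq =>
        simp only [List.cons_append, List.cons.injEq] at hpq
        exact ha₁ (hp.subset (by simp [hpq.1]))
    · exact tl p q hpq.symm hp hq hxa
  | cons_cons _ h =>
    obtain ⟨p, q, hpq, hp, hq⟩ := List.sublist_append_iff.1 h
    match p, hpq with
    | [], hpq =>
      simp only [List.nil_append] at hpq
      subst hpq
      cases hq with
      | cons _ h => exact ha₂ (h.subset (by simp))
      | cons_cons _ h => exact hxy rfl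
    | [b], hpq =>
      simp only [List.cons_append, List.nil_append, List.cons.injEq] at hpq
      obtain ⟨rfl, rfl⟩ := hpq
      have h1 : y ∈ l₁ := hp.subset (by simp)
      have : y ∈ _ := hq.subset (by simp)
      grind
    | b :: c :: p', hpq =>
      simp only [List.cons_append, List.cons.injEq] at hpq
      exact ha₁ (hp.subset (by simp [hpq.2.1]))

theorem card_ncWords_rec {α : Type*} [DecidableEq α] (S : Finset α) (hS : S.Nonempty) :
    (ncWords S).card = ∑ a ∈ S, ∑ T ∈ (S.erase a).powerset,
      (ncWords T).card * (ncWords (S.erase a \ T)).card := by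
  have : ∑ a ∈ S, ∑ T ∈ (S.erase a).powerset,
      (ncWords T).card * (ncWords (S.erase a \ T)).card =
      (S.sigma fun a => (S.erase a).powerset.sigma
        fun T => ncWords T ×ˢ ncWords (S.erase a \ T)).card := by
    simp [Finset.card_sigma, Finset.card_product]
  rw [this]
  symm
  refine Finset.card_bij (fun z _ => z.1 :: (z.2.2.1 ++ z.1 :: z.2.2.2)) ?_ ?_ ?_
  · rintro ⟨a, T, l₁, l₂⟩ hz
    simp only [Finset.mem_sigma, Finset.mem_powerset, Finset.mem_product] at hz
    obtain ⟨ha, hT, h1, h2⟩ := hz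
    have m1 := mem_of_ncWords h1
    have m2 := mem_of_ncWords h2
    rw [mem_ncWords] at h1 h2 ⊢
    refine ⟨?_, ncList_join h1.2 h2.2 ?_ ?_ ?_⟩
    · intro x
      have c1 := h1.1 x
      have c2 := h2.1 x
      have hTx := @hT x
      simp only [List.count_cons, List.count_append, c1, c2]
      simp only [Finset.mem_sdiff, Finset.mem_erase] at *
      by_cases hxa : a = x
      · subst hxa
        have : a ∉ T := fun h => (hTx h).1 rfl
        simp [this, ha]
      · by_cases hxT : x ∈ T
        · simp [hxT, hxa, (hTx hxT).2]
        · have : x ≠ a := fun h => hxa h.symm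
          by_cases hxS : x ∈ S <;> simp [hxT, hxa, hxS, this]
    · rw [m1]; intro h; simpa using hT h
    · rw [m2]; simp
    · intro x; rw [m1, m2]; intro h; simp [h]
  · rintro ⟨a, T, l₁, l₂⟩ hz ⟨a', T', l₁', l₂'⟩ hz' heq
    simp only [Finset.mem_sigma, Finset.mem_powerset, Finset.mem_product] at hz hz'
    obtain ⟨ha, hT, h1, h2⟩ := hz
    obtain ⟨ha', hT', h1', h2'⟩ := hz'
    simp only [List.cons.injEq] at heq
    obtain ⟨rfl, heq⟩ := heq
    have m1 := mem_of_ncWords h1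
    have m1' := mem_of_ncWords h1'
    have n1 : a ∉ l₁ := by rw [m1]; intro h; simpa using hT h
    have n1' : a ∉ l₁' := by rw [m1']; intro h; simpa using hT' h
    have e : l₁ = l₁' ∧ l₂ = l₂' := by
      rw [List.append_eq_append_iff] at heq
      rcases heq with ⟨c, hc, hc'⟩ | ⟨c, hc, hc'⟩ <;> cases c <;> grind
    obtain ⟨rfl, rfl⟩ := e
    have : T = T' := by ext x; rw [← m1, ← m1']
    subst this
    rfl
  · intro l hl
    have ml := mem_of_ncWords hl
    rw [mem_ncWords] at hl
    obtain ⟨hc, hn⟩ := hl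
    match l, hS with
    | [], ⟨s, hs⟩ => simpa using (ml s).2 hs
    | a :: t, _ =>
      have haS : a ∈ S := (ml a).1 (by simp)
      have hca := hc a
      simp only [List.count_cons_self, haS, if_true] at hca
      have hat : a ∈ t := List.count_pos_iff.1 (by omega)
      obtain ⟨l₁, l₂, rfl, hal₁⟩ := List.eq_append_cons_of_mem hat
      have hal₂ : a ∉ l₂ := by
        simp only [List.count_append, List.count_cons_self] at hca
        exact List.count_eq_zero.1 (by omega)
      have hd : ∀ x ∈ l₁, x ∉ l₂ := by
        intro x h1 h2
        refine hn a x (by rintro rfl; exact hal₁ h1) ?_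
        refine List.Sublist.cons_cons a ?_
        exact List.Sublist.append (List.singleton_sublist.2 h1)
          (List.Sublist.cons_cons a (List.singleton_sublist.2 h2))
      have hs1 : List.Sublist l₁ (a :: (l₁ ++ a :: l₂)) :=
        (List.sublist_append_left _ _).trans (List.sublist_cons_self _ _)
      have hs2 : List.Sublist l₂ (a :: (l₁ ++ a :: l₂)) :=
        ((List.sublist_cons_self _ _).trans (List.sublist_append_right _ _)).trans
          (List.sublist_cons_self _ _)
      refine ⟨⟨a, l₁.toFinset, l₁, l₂⟩, ?_, rfl⟩
      simp only [Finset.mem_sigma, Finset.mem_powerset, Finset.mem_product]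
      refine ⟨haS, ?_, ?_, ?_⟩
      · intro x hx
        rw [List.mem_toFinset] at hx
        rw [Finset.mem_erase]
        exact ⟨by rintro rfl; exact hal₁ hx, (ml x).1 (hs1.subset hx)⟩
      · rw [mem_ncWords]
        refine ⟨fun x => ?_, hn.sublist hs1⟩
        simp only [List.mem_toFinset]
        split_ifs with hx
        · have h := hc x
          have hxa : a ≠ x := by rintro rfl; exact hal₁ hx
          rw [if_pos ((ml x).1 (hs1.subset hx))] at h
          have h0 := List.count_eq_zero.2 (hd x hx)
          simpa [List.count_cons, hxa, h0] using h
        · exact List.count_eq_zero.2 hx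
      · rw [mem_ncWords]
        refine ⟨fun x => ?_, hn.sublist hs2⟩
        have h := hc x
        have mx := ml x
        simp only [Finset.mem_sdiff, Finset.mem_erase, List.mem_toFinset]
        by_cases hx : x ∈ l₂
        · have hxa : x ≠ a := by rintro rfl; exact hal₂ hx
          have hx1 : x ∉ l₁ := fun h' => hd x h' hx
          have hxS := (ml x).1 (hs2.subset hx)
          have h0 := List.count_eq_zero.2 hx1
          rw [if_pos hxS] at h
          rw [if_pos ⟨⟨hxa, hxS⟩, hx1⟩]
          simpa [List.count_cons, hxa.symm, h0] using h
        · rw [List.count_eq_zero.2 hx, if_neg]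
          rintro ⟨⟨hxa, hxS⟩, hx1⟩
          have := mx.2 hxS
          simp [hxa, hx1, hx] at this

theorem card_ncWords {α : Type*} [DecidableEq α] (n : ℕ) : ∀ S : Finset α, S.card = n →
    (ncWords S).card = n.factorial * catalan n := by
  induction n using Nat.strong_induction_on with
  | _ n ih =>
    intro S hS
    cases n with
    | zero =>
      rw [Finset.card_eq_zero] at hS
      subst hS
      have : ncWords (∅ : Finset α) = {[]} := by
        ext l
        rw [mem_ncWords, Finset.mem_singleton]
        constructor
        · rintro ⟨h, -⟩
          refine List.eq_nil_iff_forall_not_mem.2 fun x hx => ?_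
          have := h x
          simp only [Finset.notMem_empty, if_false] at this
          exact List.count_eq_zero.1 this hx
        · rintro rfl
          exact ⟨by simp, fun x y _ h => by simp at h⟩
      simp [this]
    | succ n =>
      have hne : S.Nonempty := Finset.card_pos.1 (by omega)
      rw [card_ncWords_rec S hne]
      have inner : ∀ a ∈ S, ∑ T ∈ (S.erase a).powerset,
          (ncWords T).card * (ncWords (S.erase a \ T)).card = n.factorial * catalan (n + 1) := by
        intro a ha
        have hc : (S.erase a).card = n := by rw [Finset.card_erase_of_mem ha, hS]; rfl
        have h1 : ∀ T ∈ (S.erase a).powerset,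
            (ncWords T).card * (ncWords (S.erase a \ T)).card =
            (fun k => (k.factorial * catalan k) * ((n - k).factorial * catalan (n - k))) T.card := by
          intro T hT
          rw [Finset.mem_powerset] at hT
          have hle := Finset.card_le_card hT
          have hsd := Finset.card_sdiff_of_subset hT
          rw [ih T.card (by omega) T rfl, ih (n - T.card) (by omega) _ (by omega)]
        rw [Finset.sum_congr rfl h1, Finset.sum_powerset_apply_card
          (fun k => (k.factorial * catalan k) * ((n - k).factorial * catalan (n - k))), hc, catalan_succ,
          Finset.mul_sum, Finset.sum_range]
        refine Finset.sum_congr rfl fun k _ => ?_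
        have hk : (k : ℕ) ≤ n := by omega
        rw [← Nat.choose_mul_factorial_mul_factorial hk, smul_eq_mul]
        ring
      rw [Finset.sum_congr rfl inner, Finset.sum_const, hS, Nat.factorial_succ, smul_eq_mul]
      ring

theorem nonCrossing_iff {n : ℕ} (π : Fin (2*n) → Fin n) :
    NonCrossing π ↔ NCList (List.ofFn π) := by
  constructor
  · intro h x y hxy hs
    apply h
    obtain ⟨f, hf⟩ := List.sublist_iff_exists_fin_orderEmbedding_get_eq.1 hs
    have hl : (List.ofFn π).length = 2 * n := List.length_ofFn
    have g : ∀ i, π (Fin.cast hl (f i)) = [x, y, x, y].get i := by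
      intro i
      rw [hf i]
      simp
      rfl
    have m : ∀ i j : Fin 4, i < j → Fin.cast hl (f i) < Fin.cast hl (f j) := by
      intro i j hij
      exact f.lt_iff_lt.2 hij
    refine ⟨_, _, _, _, m 0 1 (by decide), m 1 2 (by decide), m 2 3 (by decide), ?_, ?_, ?_⟩
    · exact (g 0).trans (g 2).symm
    · exact (g 1).trans (g 3).symm
    · intro h
      exact hxy (((g 0).symm.trans h).trans (g 1))
  · rintro h ⟨i, j, k, l, hij, hjk, hkl, h1, h2, h3⟩
    refine h (π i) (π j) h3 ?_
    have : [π i, π j, π i, π j] = [i, j, k, l].map π := by simp [h1, h2]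
    rw [this, List.ofFn_eq_map]
    refine List.Sublist.map _ ?_
    apply List.sublist_of_subperm_of_pairwise (r := (· < ·))
    · exact List.subperm_of_subset (by simp; omega) (by simp [List.subset_def])
    · simp; omega
    · exact List.pairwise_lt_finRange _

theorem isMultisetPerm_iff {n : ℕ} (π : Fin (2*n) → Fin n) :
    IsMultisetPerm π ↔ ∀ x, (List.ofFn π).count x = if x ∈ Finset.univ then 2 else 0 := by
  unfold IsMultisetPerm
  refine forall_congr' fun v => ?_
  have : (List.ofFn π).count v = (Finset.univ.filter fun i => π i = v).card := by
    rw [List.ofFn_eq_map, ← Multiset.coe_count, ← Multiset.map_coe, Multiset.count_map]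
    simp only [eq_comm (a := v)]
    rfl
  rw [this]
  simp

theorem stmt1 (n : ℕ) :
    Nat.card {π : Fin (2*n) → Fin n // IsMultisetPerm π ∧ NonCrossing π} =
      n.factorial * (Nat.choose (2*n) n / (n+1)) := by
  have hcat : Nat.choose (2*n) n / (n+1) = catalan n := by
    rw [catalan_eq_centralBinom_div]; rfl
  rw [hcat, ← card_ncWords n (Finset.univ : Finset (Fin n)) (by simp), ← Fintype.card_coe,
    ← Nat.card_eq_fintype_card]
  refine Nat.card_eq_of_bijective (fun π => ⟨List.ofFn π.1, by
    rw [mem_ncWords, ← isMultisetPerm_iff, ← nonCrossing_iff]; exact π.2⟩) ⟨?_, ?_⟩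
  · intro π ρ h
    exact Subtype.ext (List.ofFn_injective (congrArg Subtype.val h))
  · rintro ⟨l, hl⟩
    have hl' := mem_ncWords.1 hl
    have hlen : l.length = 2 * n := by
      have := Multiset.sum_count_eq_card (s := (Finset.univ : Finset (Fin n))) (m := (l : Multiset (Fin n)))
        (by simp)
      simp only [Multiset.coe_count, hl'.1] at this
      simp at this
      omega
    have e : List.ofFn (fun i : Fin (2*n) => l.get (Fin.cast hlen.symm i)) = l := by
      apply List.ext_get
      · simp [hlen]
      · intros; simp
    refine ⟨⟨fun i => l.get (Fin.cast hlen.symm i), ?_⟩, Subtype.ext e⟩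
    rw [isMultisetPerm_iff, nonCrossing_iff, e]
    exact hl'
end

section
/- Let p_n denote the number of non-nesting 231-avoiding permutations of {1,1,...,n,n} and let r_n denote the number of such permutations whose last entry is n. Then r_1 = 1 and for all n ≥ 2, r_n = p_{n-1} + r_{n-1}. -/
/-- Number of non-nesting 231-avoiding permutations of {1,1,...,n,n}. -/
noncomputable def pNN (n : ℕ) : ℕ :=
  Nat.card {π : Fin (2*n) → Fin n // IsMultisetPerm π ∧ NonNesting π ∧ Avoids231 π}

/-- Those whose last entry is n. -/
noncomputable def rNN (n : ℕ) : ℕ :=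
  Nat.card {π : Fin (2*n) → Fin n //
    IsMultisetPerm π ∧ NonNesting π ∧ Avoids231 π ∧ LastIsMax π}

/-- The order embedding of positions that skips `c` (and the last position `2m+1`). -/
def skipPos (m c : ℕ) (i : Fin (2*m)) : Fin (2*(m+1)) :=
  ⟨if i.val < c then i.val else i.val + 1, by have := i.2; split <;> omega⟩

theorem skipPos_lt {m c : ℕ} {i j : Fin (2*m)} : skipPos m c i < skipPos m c j ↔ i < j := by
  simp only [skipPos, Fin.lt_def]
  split <;> split <;> omega

theorem skipPos_inj {m c : ℕ} {i j : Fin (2*m)} : skipPos m c i = skipPos m c j ↔ i = j := by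
  simp only [skipPos, Fin.ext_iff]
  split <;> split <;> omega

theorem skipPos_ne {m c : ℕ} (hc : c ≤ 2*m) (i : Fin (2*m)) :
    (skipPos m c i).val ≠ c ∧ (skipPos m c i).val ≠ 2*m+1 := by
  have := i.2
  simp only [skipPos]
  split <;> omega

theorem skipPos_surj {m c : ℕ} (hc : c ≤ 2*m) (j : Fin (2*(m+1))) (h1 : j.val ≠ c)
    (h2 : j.val ≠ 2*m+1) : ∃ i, skipPos m c i = j := by
  have := j.2
  by_cases h : j.val < c
  · exact ⟨⟨j.val, by omega⟩, by simp [skipPos, Fin.ext_iff]; omega⟩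
  · exact ⟨⟨j.val - 1, by omega⟩, by simp only [skipPos, Fin.ext_iff]; split <;> omega⟩

/-- `π` is obtained from `σ` by inserting the new maximum at `c` and at the end. -/
def Ins (m c : ℕ) (π : Fin (2*(m+1)) → Fin (m+1)) (σ : Fin (2*m) → Fin m) : Prop :=
  (∀ i, (π (skipPos m c i)).val = (σ i).val) ∧
  (∀ j, (j.val = c ∨ j.val = 2*m+1) → (π j).val = m)

theorem Ins.lt {m c : ℕ} {π : Fin (2*(m+1)) → Fin (m+1)} {σ : Fin (2*m) → Fin m}
    (h : Ins m c π σ) (hc : c ≤ 2*m) (j) : (π j).val = m ↔ (j.val = c ∨ j.val = 2*m+1) := by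
  refine ⟨fun hj => ?_, h.2 j⟩
  by_contra hn
  push Not at hn
  obtain ⟨i, rfl⟩ := skipPos_surj hc j hn.1 hn.2
  have := h.1 i
  have := (σ i).2
  omega

theorem Ins.card {m c : ℕ} {π : Fin (2*(m+1)) → Fin (m+1)} {σ : Fin (2*m) → Fin m}
    (h : Ins m c π σ) (hc : c ≤ 2*m) (w : Fin m) :
    (Finset.univ.filter fun j => π j = w.castSucc).card =
      (Finset.univ.filter fun i => σ i = w).card := by
  rw [← Finset.card_image_of_injective (Finset.univ.filter fun i => σ i = w)
    (f := skipPos m c) (fun a b hab => skipPos_inj.1 hab)]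
  congr 1
  ext j
  simp only [Finset.mem_filter, Finset.mem_univ, true_and, Finset.mem_image]
  constructor
  · intro hj
    have hne : ¬ (π j).val = m := by
      rw [hj]; have := w.2; simp; omega
    rw [h.lt hc j] at hne
    push Not at hne
    obtain ⟨i, rfl⟩ := skipPos_surj hc j hne.1 hne.2
    refine ⟨i, ?_, rfl⟩
    have := h.1 i
    rw [hj] at this
    exact Fin.ext this.symm
  · rintro ⟨i, rfl, rfl⟩
    exact Fin.ext (h.1 i)

theorem Ins.perm_iff {m c : ℕ} {π : Fin (2*(m+1)) → Fin (m+1)} {σ : Fin (2*m) → Fin m}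
    (h : Ins m c π σ) (hc : c ≤ 2*m) : IsMultisetPerm π ↔ IsMultisetPerm σ := by
  constructor
  · intro hp w
    rw [← h.card hc]; exact hp _
  · intro hp v
    induction v using Fin.lastCases with
    | cast w => rw [h.card hc]; exact hp w
    | last =>
      have : (Finset.univ.filter fun j => π j = Fin.last m) =
          {(⟨c, by omega⟩ : Fin (2*(m+1))), ⟨2*m+1, by omega⟩} := by
        ext j
        have := h.lt hc j
        simp only [Finset.mem_filter, Finset.mem_univ, true_and, Finset.mem_insert,
          Finset.mem_singleton, Fin.ext_iff, Fin.val_last]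
        exact this
      rw [this, Finset.card_pair]
      simp only [ne_eq, Fin.ext_iff]; omega

theorem Ins.down {m c : ℕ} {π : Fin (2*(m+1)) → Fin (m+1)} {σ : Fin (2*m) → Fin m}
    (h : Ins m c π σ) : (NonNesting π → NonNesting σ) ∧ (Avoids231 π → Avoids231 σ) := by
  constructor
  · rintro hp ⟨i, j, k, l, h1, h2, h3, h4, h5, h6⟩
    refine hp ⟨skipPos m c i, skipPos m c j, skipPos m c k, skipPos m c l, skipPos_lt.2 h1,
      skipPos_lt.2 h2, skipPos_lt.2 h3, ?_, ?_, ?_⟩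
    · rw [Fin.ext_iff, h.1, h.1, h4]
    · rw [Fin.ext_iff, h.1, h.1, h5]
    · rw [ne_eq, Fin.ext_iff, h.1, h.1, ← Fin.ext_iff]; exact h6
  · rintro hp ⟨i, j, k, h1, h2, h3, h4⟩
    refine hp ⟨skipPos m c i, skipPos m c j, skipPos m c k, skipPos_lt.2 h1,
      skipPos_lt.2 h2, ?_, ?_⟩
    · rw [Fin.lt_def, h.1, h.1]; exact h3
    · rw [Fin.lt_def, h.1, h.1]; exact h4

theorem Ins.nonNesting {m c : ℕ} {π : Fin (2*(m+1)) → Fin (m+1)} {σ : Fin (2*m) → Fin m}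
    (h : Ins m c π σ) (hc : c ≤ 2*m) (hc' : 2*m ≤ c+1) (hσ : NonNesting σ) : NonNesting π := by
  rintro ⟨i, j, k, l, h1, h2, h3, h4, h5, h6⟩
  have hi := h.lt hc i
  have hj := h.lt hc j
  have hk := h.lt hc k
  have hl := h.lt hc l
  have h4' := congrArg Fin.val h4
  have h5' := congrArg Fin.val h5
  have := l.2
  rw [Fin.lt_def] at h1 h2 h3
  have ni : ¬ (π i).val = m := by
    intro e
    have e1 := hi.1 e
    have e2 := hl.1 (h4'.symm.trans e)
    omega
  have nj : ¬ (π j).val = m := by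
    intro e
    have e1 := hj.1 e
    have e2 := hk.1 (h5'.symm.trans e)
    omega
  have nl : ¬ (π l).val = m := by omega
  have nk : ¬ (π k).val = m := by omega
  rw [hi] at ni
  rw [hj] at nj
  rw [hk] at nk
  rw [hl] at nl
  push Not at ni nj nk nl
  obtain ⟨i, rfl⟩ := skipPos_surj hc i ni.1 ni.2
  obtain ⟨j, rfl⟩ := skipPos_surj hc j nj.1 nj.2
  obtain ⟨k, rfl⟩ := skipPos_surj hc k nk.1 nk.2
  obtain ⟨l, rfl⟩ := skipPos_surj hc l nl.1 nl.2
  rw [h.1, h.1] at h4' h5'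
  refine hσ ⟨i, j, k, l, skipPos_lt.1 h1, skipPos_lt.1 h2, skipPos_lt.1 h3, Fin.ext h4',
    Fin.ext h5', fun e => h6 ?_⟩
  rw [Fin.ext_iff, h.1, h.1, e]

theorem Ins.avoids {m c : ℕ} {π : Fin (2*(m+1)) → Fin (m+1)} {σ : Fin (2*m) → Fin m}
    (h : Ins m c π σ) (hc : c ≤ 2*m) (hc' : 2*m ≤ c+1)
    (hl : c + 1 = 2*m → ∀ j : Fin (2*(m+1)), j.val = 2*m → (π j).val = m-1)
    (hσ : Avoids231 σ) : Avoids231 π := by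
  rintro ⟨i, j, k, h1, h2, h3, h4⟩
  have hi := h.lt hc i
  have hj := h.lt hc j
  have hk := h.lt hc k
  have := k.2
  have := (π j).2
  rw [Fin.lt_def] at h1 h2 h3 h4
  have ni : ¬ (π i).val = m := by omega
  have nk : ¬ (π k).val = m := by omega
  have nj : ¬ (π j).val = m := by
    intro e
    have e1 := hj.1 e
    have := hl (by omega) k (by omega)
    omega
  rw [hi] at ni
  rw [hj] at nj
  rw [hk] at nk
  push Not at ni nj nk
  obtain ⟨i, rfl⟩ := skipPos_surj hc i ni.1 ni.2
  obtain ⟨j, rfl⟩ := skipPos_surj hc j nj.1 nj.2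
  obtain ⟨k, rfl⟩ := skipPos_surj hc k nk.1 nk.2
  rw [h.1, h.1] at h3 h4
  exact hσ ⟨i, j, k, skipPos_lt.1 h1, skipPos_lt.1 h2, h3, h4⟩

/-- The explicit insertion. -/
def insMap (m c : ℕ) (hc : c ≤ 2*m) (σ : Fin (2*m) → Fin m) (j : Fin (2*(m+1))) : Fin (m+1) :=
  if h : j.val = c ∨ j.val = 2*m+1 then Fin.last m
  else (σ ⟨if j.val < c then j.val else j.val - 1, by
    have := j.2
    push Not at h
    split <;> omega⟩).castSucc

theorem insMap_ins (m c : ℕ) (hc : c ≤ 2*m) (σ : Fin (2*m) → Fin m) :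
    Ins m c (insMap m c hc σ) σ := by
  constructor
  · intro i
    have h1 := skipPos_ne hc i
    have h2 : ¬ ((skipPos m c i).val = c ∨ (skipPos m c i).val = 2*m+1) := by tauto
    simp only [insMap, h2, dif_neg, not_false_eq_true, Fin.val_castSucc]
    congr 2
    simp only [skipPos, Fin.ext_iff]
    split_ifs <;> omega
  · intro j hj
    simp [insMap, hj]

theorem Ins.unique {m c : ℕ} {π π' : Fin (2*(m+1)) → Fin (m+1)} {σ : Fin (2*m) → Fin m}
    (hc : c ≤ 2*m) (h : Ins m c π σ) (h' : Ins m c π' σ) : π = π' := by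
  funext j
  by_cases hj : j.val = c ∨ j.val = 2*m+1
  · exact Fin.ext ((h.2 j hj).trans (h'.2 j hj).symm)
  · push Not at hj
    obtain ⟨i, rfl⟩ := skipPos_surj hc j hj.1 hj.2
    exact Fin.ext ((h.1 i).trans (h'.1 i).symm)

theorem Ins.unique' {m c : ℕ} {π : Fin (2*(m+1)) → Fin (m+1)} {σ σ' : Fin (2*m) → Fin m}
    (h : Ins m c π σ) (h' : Ins m c π σ') : σ = σ' := by
  funext i
  exact Fin.ext ((h.1 i).symm.trans (h'.1 i))

theorem exists_other {n : ℕ} {π : Fin (2*n) → Fin n} (hp : IsMultisetPerm π) (j : Fin (2*n)) :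
    ∃ j', j' ≠ j ∧ ∀ k, π k = π j ↔ k = j ∨ k = j' := by
  have h2 := hp (π j)
  rw [Finset.card_eq_two] at h2
  obtain ⟨x, y, hxy, e⟩ := h2
  have key : ∀ k, π k = π j ↔ k = x ∨ k = y := by
    intro k
    have := Finset.ext_iff.1 e k
    simpa using this
  rcases (key j).1 rfl with r | r
  · subst r
    exact ⟨y, hxy.symm, key⟩
  · subst r
    exact ⟨x, hxy, fun k => (key k).trans or_comm⟩

theorem exists_ins {m : ℕ} (hm : 1 ≤ m) {π : Fin (2*(m+1)) → Fin (m+1)}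
    (hp : IsMultisetPerm π) (hn : NonNesting π) (ha : Avoids231 π) (hl : LastIsMax π) :
    ∃ c, (c = 2*m ∨ (c + 1 = 2*m ∧ ∀ j : Fin (2*(m+1)), j.val = 2*m → (π j).val = m-1)) ∧
      ∃ σ, Ins m c π σ := by
  obtain ⟨_, hl⟩ := hl
  obtain ⟨c, hc, hcc⟩ := exists_other hp ⟨2*(m+1)-1, by omega⟩
  rw [hl] at hcc
  have hmax : ∀ k, (π k).val = m ↔ (k.val = c.val ∨ k.val = 2*m+1) := by
    intro k
    have := hcc k
    simp only [Fin.ext_iff] at this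
    omega
  have hcl : c.val ≤ 2*m := by
    have := c.2
    simp only [ne_eq, Fin.ext_iff] at hc
    omega
  -- entries strictly between the two maxima occur before `c`
  have hbet : ∀ j : Fin (2*(m+1)), c < j → j.val < 2*m+1 → ∃ j', j' < c ∧ π j' = π j := by
    intro j h1 h2
    obtain ⟨j', hj', hk⟩ := exists_other hp j
    have e := (hk j').2 (Or.inr rfl)
    refine ⟨j', ?_, e⟩
    have a1 := hmax j
    have a2 := hmax j'
    rw [e] at a2
    have := j'.2
    rw [Fin.lt_def] at h1 ⊢
    by_contra hcon
    have hne : π c ≠ π j := by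
      intro e'
      have := (hmax c).2 (Or.inl rfl)
      rw [e'] at this
      omega
    have hcl' : π c = π ⟨2*m+1, by omega⟩ := by
      apply Fin.ext
      rw [(hmax c).2 (Or.inl rfl), (hmax _).2 (Or.inr rfl)]
    have hjj : j'.val ≠ j.val := fun e => hj' (Fin.ext e)
    rcases lt_or_gt_of_ne hjj with q | q
    · exact hn ⟨c, j', j, ⟨2*m+1, by omega⟩, by rw [Fin.lt_def]; omega, q, h2, hcl', e,
        by rw [e]; exact hne⟩
    · exact hn ⟨c, j, j', ⟨2*m+1, by omega⟩, h1, q, by rw [Fin.lt_def]; simp only; omega, hcl',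
        e.symm, hne⟩
  have hcm := (hmax c).2 (Or.inl rfl)
  -- entries before `c` are at most entries after
  have hle : ∀ i k : Fin (2*(m+1)), i < c → c < k → (π i).val ≤ (π k).val := by
    intro i k h1 h2
    by_contra hcon
    have a := hmax i
    have := (π i).2
    rw [Fin.lt_def] at h1
    exact ha ⟨i, c, k, h1, h2, by rw [Fin.lt_def]; omega, by rw [Fin.lt_def]; omega⟩
  have hge : 2*m ≤ c.val + 1 := by
    by_contra hcon
    have l1 : c < (⟨2*m-1, by omega⟩ : Fin (2*(m+1))) := by rw [Fin.lt_def]; simp only; omega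
    have l2 : c < (⟨2*m, by omega⟩ : Fin (2*(m+1))) := by rw [Fin.lt_def]; simp only; omega
    obtain ⟨u, hu, eu⟩ := hbet _ l1 (by simp only; omega)
    obtain ⟨v, hv, ev⟩ := hbet _ l2 (by simp only; omega)
    have b1 := hle u _ hu l2
    have b2 := hle v _ hv l1
    rw [eu] at b1
    rw [ev] at b2
    have e : π ⟨2*m-1, by omega⟩ = π ⟨2*m, by omega⟩ := Fin.ext (le_antisymm b1 b2)
    refine hn ⟨c, ⟨2*m-1, by omega⟩, ⟨2*m, by omega⟩, ⟨2*m+1, by omega⟩, l1, ?_, ?_, ?_, e, ?_⟩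
    · rw [Fin.lt_def]; simp only; omega
    · rw [Fin.lt_def]; simp only; omega
    · apply Fin.ext
      rw [hcm, (hmax _).2 (Or.inr rfl)]
    · intro e'
      have a := hmax ⟨2*m-1, by omega⟩
      rw [← e'] at a
      simp only at a
      omega
  refine ⟨c.val, ?_, ?_⟩
  · by_cases h : c.val = 2*m
    · exact Or.inl h
    · refine Or.inr ⟨by omega, fun j hj => ?_⟩
      have hv := hp ⟨m-1, by omega⟩
      obtain ⟨p, hpm⟩ := Finset.card_pos.1 (by rw [hv]; norm_num)
      simp only [Finset.mem_filter, Finset.mem_univ, true_and] at hpm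
      have hpv := congrArg Fin.val hpm
      simp only at hpv
      have a := hmax p
      have b := hmax j
      have := (π j).2
      have := p.2
      by_cases hpc : p < c
      · have := hle p j hpc (by rw [Fin.lt_def]; omega)
        omega
      · rw [Fin.lt_def] at hpc
        have : p = j := Fin.ext (by omega)
        rw [← this]; exact hpv
  · refine ⟨fun i => ⟨(π (skipPos m c i)).val, ?_⟩, fun i => rfl, fun j hj => (hmax j).2 hj⟩
    have := skipPos_ne hcl i
    have a := hmax (skipPos m c i)
    have := (π (skipPos m c i)).2
    omega

theorem lastIsMax_iff {n : ℕ} (hn : 0 < n) (π : Fin (2*n) → Fin n) :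
    LastIsMax π ↔ ∀ j : Fin (2*n), j.val = 2*n-1 → (π j).val = n-1 := by
  constructor
  · rintro ⟨_, h⟩ j hj
    have : j = ⟨2*n-1, by omega⟩ := Fin.ext hj
    rw [this, h]
  · intro h
    exact ⟨hn, Fin.ext (h _ rfl)⟩

theorem Ins.last_iff {m c : ℕ} {π : Fin (2*(m+1)) → Fin (m+1)} {σ : Fin (2*m) → Fin m}
    (hm : 1 ≤ m) (h : Ins m c π σ) (hc : c + 1 = 2*m) :
    LastIsMax σ ↔ ∀ j : Fin (2*(m+1)), j.val = 2*m → (π j).val = m-1 := by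
  rw [lastIsMax_iff (by omega)]
  have e : skipPos m c ⟨2*m-1, by omega⟩ = ⟨2*m, by omega⟩ := by
    simp only [skipPos, Fin.ext_iff]
    split <;> omega
  have h1 := h.1 ⟨2*m-1, by omega⟩
  rw [e] at h1
  constructor
  · intro hs j hj
    have : j = ⟨2*m, by omega⟩ := Fin.ext hj
    rw [this, h1]
    exact hs _ rfl
  · intro hs j hj
    have : j = ⟨2*m-1, by omega⟩ := Fin.ext hj
    rw [this, ← h1]
    exact hs _ rfl

theorem Ins.lastIsMax {m c : ℕ} {π : Fin (2*(m+1)) → Fin (m+1)} {σ : Fin (2*m) → Fin m}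
    (h : Ins m c π σ) : LastIsMax π := by
  rw [lastIsMax_iff (by omega)]
  intro j hj
  exact h.2 j (Or.inr (by omega))

theorem rNN_step (m : ℕ) (hm : 1 ≤ m) : rNN (m+1) = pNN m + rNN m := by
  unfold rNN pNN
  rw [← Nat.card_sum]
  symm
  refine Nat.card_congr (Equiv.ofBijective (Sum.elim
    (fun s => ⟨insMap m (2*m) le_rfl s.1, ?_⟩)
    (fun s => ⟨insMap m (2*m-1) (by omega) s.1, ?_⟩)) ⟨?_, ?_⟩)
  · have h := insMap_ins m (2*m) le_rfl s.1
    exact ⟨(h.perm_iff le_rfl).2 s.2.1, h.nonNesting le_rfl (by omega) s.2.2.1,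
      h.avoids le_rfl (by omega) (by omega) s.2.2.2, h.lastIsMax⟩
  · have h := insMap_ins m (2*m-1) (by omega) s.1
    exact ⟨(h.perm_iff (by omega)).2 s.2.1, h.nonNesting (by omega) (by omega) s.2.2.1,
      h.avoids (by omega) (by omega) (fun hc => (h.last_iff hm hc).1 s.2.2.2.2) s.2.2.2.1,
      h.lastIsMax⟩
  · have hdis : ∀ s t, insMap m (2*m) le_rfl s = insMap m (2*m-1) (by omega) t → False := by
      intro s t e
      have h1 := insMap_ins m (2*m) le_rfl s
      have h2 := insMap_ins m (2*m-1) (by omega) t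
      have a := (h1.lt le_rfl ⟨2*m, by omega⟩).2 (Or.inl rfl)
      rw [e, h2.lt (by omega)] at a
      simp only at a
      omega
    rintro (⟨s, hs⟩ | ⟨s, hs⟩) (⟨t, ht⟩ | ⟨t, ht⟩) e
    · simp only [Sum.elim_inl, Subtype.mk.injEq] at e
      have h1 := insMap_ins m (2*m) le_rfl s
      rw [e] at h1
      have := h1.unique' (insMap_ins m (2*m) le_rfl t)
      subst this; rfl
    · simp only [Sum.elim_inl, Sum.elim_inr, Subtype.mk.injEq] at e
      exact (hdis _ _ e).elim
    · simp only [Sum.elim_inl, Sum.elim_inr, Subtype.mk.injEq] at e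
      exact (hdis _ _ e.symm).elim
    · simp only [Sum.elim_inr, Subtype.mk.injEq] at e
      have h1 := insMap_ins m (2*m-1) (by omega) s
      rw [e] at h1
      have := h1.unique' (insMap_ins m (2*m-1) (by omega) t)
      subst this; rfl
  · rintro ⟨π, hp, hn, ha, hl⟩
    obtain ⟨c, hc, σ, h⟩ := exists_ins hm hp hn ha hl
    rcases hc with rfl | ⟨hc, hj⟩
    · refine ⟨Sum.inl ⟨σ, (h.perm_iff le_rfl).1 hp, h.down.1 hn, h.down.2 ha⟩, ?_⟩
      exact Subtype.ext ((insMap_ins m (2*m) le_rfl σ).unique le_rfl h)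
    · refine ⟨Sum.inr ⟨σ, (h.perm_iff (by omega)).1 hp, h.down.1 hn, h.down.2 ha,
        (h.last_iff hm hc).2 hj⟩, ?_⟩
      obtain rfl : c = 2*m-1 := by omega
      exact Subtype.ext ((insMap_ins m (2*m-1) (by omega) σ).unique (by omega) h)

theorem rNN_one : rNN 1 = 1 := by
  unfold rNN
  rw [Nat.card_eq_one_iff_unique]
  refine ⟨⟨fun a b => Subtype.ext (funext fun i => Subsingleton.elim _ _)⟩, ⟨fun _ => 0, ?_, ?_, ?_, ?_⟩⟩
  · intro v
    rw [Finset.filter_true_of_mem (fun i _ => Subsingleton.elim _ _)]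
    rfl
  · rintro ⟨i, j, k, l, h⟩
    exact h.2.2.2.2.2 rfl
  · rintro ⟨i, j, k, h⟩
    exact lt_irrefl _ h.2.2.1
  · exact ⟨one_pos, rfl⟩

theorem stmt5 : rNN 1 = 1 ∧ ∀ n, 2 ≤ n → rNN n = pNN (n-1) + rNN (n-1) := by
  refine ⟨rNN_one, fun n hn => ?_⟩
  obtain ⟨m, rfl⟩ : ∃ m, n = m + 1 := ⟨n - 1, by omega⟩
  exact rNN_step m (by omega)
end

section
/- Let p_n, q_n, r_n denote respectively the number of non-nesting 231-avoiding permutations of {1,1,...,n,n}, those with first entry 1, and those with last entry n, with p_0=1, q_0=r_0=0. Then for all n ≥ 3, p_n = 2·Σ_{k=1}^{n-2} r_k q_{n-k-1} + Σ_{k=0}^{n-2} p_k q_{n-k-1} + Σ_{k=1}^{n-1} r_k p_{n-k-1} + Σ_{k=0}^{n-1} p_k p_{n-k-1}. -/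
noncomputable def qNN (n : ℕ) : ℕ :=
  Nat.card {π : Fin (2*n) → Fin n //
    IsMultisetPerm π ∧ NonNesting π ∧ Avoids231 π ∧ FirstIsOne π}

namespace W
open List

def Cnt (k : ℕ) (l : List ℕ) : Prop := ∀ v, l.count v = if v < k then 2 else 0
def Av (l : List ℕ) : Prop := ∀ x y z, [x,y,z] <+ l → z < x → x < y → False
def Nn (l : List ℕ) : Prop := ∀ x y, [x,y,y,x] <+ l → x = y
def G (k : ℕ) (l : List ℕ) : Prop := Cnt k l ∧ Av l ∧ Nn l

lemma sub2 {A B : List ℕ} {x y : ℕ} (h : [x,y] <+ A ++ B) :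
    [x,y] <+ A ∨ (x ∈ A ∧ y ∈ B) ∨ [x,y] <+ B := by
  obtain ⟨s, t, e, hs, ht⟩ := List.sublist_append_iff.1 h
  rcases s with _ | ⟨a, _ | ⟨b, s⟩⟩ <;> simp_all
  grind

lemma sub3 {A B : List ℕ} {x y z : ℕ} (h : [x,y,z] <+ A ++ B) :
    [x,y,z] <+ A ∨ ([x,y] <+ A ∧ z ∈ B) ∨ (x ∈ A ∧ [y,z] <+ B) ∨ [x,y,z] <+ B := by
  obtain ⟨s, t, e, hs, ht⟩ := List.sublist_append_iff.1 h
  rcases s with _ | ⟨a, _ | ⟨b, _ | ⟨c, s⟩⟩⟩ <;> simp_all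
  grind

lemma sub4 {A B : List ℕ} {x y z w : ℕ} (h : [x,y,z,w] <+ A ++ B) :
    [x,y,z,w] <+ A ∨ ([x,y,z] <+ A ∧ w ∈ B) ∨ ([x,y] <+ A ∧ [z,w] <+ B) ∨
      (x ∈ A ∧ [y,z,w] <+ B) ∨ [x,y,z,w] <+ B := by
  obtain ⟨s, t, e, hs, ht⟩ := List.sublist_append_iff.1 h
  rcases s with _ | ⟨a, _ | ⟨b, _ | ⟨c, _ | ⟨d, s⟩⟩⟩⟩ <;> simp_all
  grind

lemma mem_of2 {A : List ℕ} {x y : ℕ} (h : [x,y] <+ A) : x ∈ A ∧ y ∈ A :=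
  ⟨h.subset (by simp), h.subset (by simp)⟩
lemma mem_of3 {A : List ℕ} {x y z : ℕ} (h : [x,y,z] <+ A) : x ∈ A ∧ y ∈ A ∧ z ∈ A :=
  ⟨h.subset (by simp), h.subset (by simp), h.subset (by simp)⟩
lemma mem_of4 {A : List ℕ} {x y z w : ℕ} (h : [x,y,z,w] <+ A) :
    x ∈ A ∧ y ∈ A ∧ z ∈ A ∧ w ∈ A :=
  ⟨h.subset (by simp), h.subset (by simp), h.subset (by simp), h.subset (by simp)⟩

lemma av_append {A C : List ℕ} (h : ∀ a ∈ A, ∀ c ∈ C, a ≤ c) :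
    Av (A ++ C) ↔ Av A ∧ Av C := by
  constructor
  · intro H
    exact ⟨fun x y z hs => H x y z (hs.trans (sublist_append_left _ _)),
      fun x y z hs => H x y z (hs.trans (sublist_append_right _ _))⟩
  · rintro ⟨h1, h2⟩ x y z hs hzx hxy
    rcases sub3 hs with h' | ⟨h', h''⟩ | ⟨h', h''⟩ | h'
    · exact h1 _ _ _ h' hzx hxy
    · have := h x (mem_of2 h').1 z h''; omega
    · have := h x h' z (mem_of2 h'').2; omega
    · exact h2 _ _ _ h' hzx hxy

lemma nn_append {A C : List ℕ} (h : ∀ a ∈ A, a ∉ C) :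
    Nn (A ++ C) ↔ Nn A ∧ Nn C := by
  constructor
  · intro H
    exact ⟨fun x y hs => H x y (hs.trans (sublist_append_left _ _)),
      fun x y hs => H x y (hs.trans (sublist_append_right _ _))⟩
  · rintro ⟨h1, h2⟩ x y hs
    rcases sub4 hs with h' | ⟨h', h''⟩ | ⟨h', h''⟩ | ⟨h', h''⟩ | h'
    · exact h1 _ _ h'
    · exact absurd h'' (h _ (mem_of3 h').1)
    · exact absurd (mem_of2 h'').2 (h _ (mem_of2 h').1)
    · exact absurd (mem_of3 h'').2.2 (h _ h')
    · exact h2 _ _ h'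

lemma filt {N : ℕ} {A : List ℕ} (h : ∀ a ∈ A, a < N) : A.filter (· ≠ N) = A := by
  rw [List.filter_eq_self]; intro a ha; have := h a ha; simp; omega

lemma filt3 {N : ℕ} {X B Y : List ℕ} (hX : ∀ a ∈ X, a < N) (hB : ∀ a ∈ B, a < N)
    (hY : ∀ a ∈ Y, a < N) : (X ++ N :: (B ++ N :: Y)).filter (· ≠ N) = X ++ (B ++ Y) := by
  have h1 := filt hX
  have h2 := filt hB
  have h3 := filt hY
  simp only [filter_append, h1, h2, filter_cons, h3]; simp

lemma sub_ins {N : ℕ} {X B Y : List ℕ} : X ++ (B ++ Y) <+ (X ++ N :: (B ++ N :: Y)) :=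
  (Sublist.refl X).append (((Sublist.refl B).append (sublist_cons_self _ _)).trans
    (sublist_cons_self _ _))

lemma av_ins {N : ℕ} {X B Y : List ℕ} (hX : ∀ a ∈ X, a < N) (hB : ∀ a ∈ B, a < N)
    (hY : ∀ a ∈ Y, a < N) : Av (X ++ N :: (B ++ N :: Y)) ↔
      Av (X ++ (B ++ Y)) ∧ (∀ a ∈ X, ∀ c ∈ B, a ≤ c) ∧ (∀ a ∈ X, ∀ c ∈ Y, a ≤ c)
       ∧ (∀ a ∈ B, ∀ c ∈ Y, a ≤ c) := by
  constructor
  · intro H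
    refine ⟨fun x y z hs => H x y z (hs.trans sub_ins), fun a ha c hc => ?_,
      fun a ha c hc => ?_, fun a ha c hc => ?_⟩
    · by_contra hh
      refine H a N c ?_ (by omega) (hX a ha)
      have h1 : [a] <+ X := by simpa
      have h2 : [N, c] <+ N :: (B ++ N :: Y) := by simp [hc]
      simpa using h1.append h2
    · by_contra hh
      refine H a N c ?_ (by omega) (hX a ha)
      have h1 : [a] <+ X := by simpa
      have h2 : [N, c] <+ N :: (B ++ N :: Y) := by simp [hc]
      simpa using h1.append h2
    · by_contra hh
      refine H a N c ?_ (by omega) (hB a ha)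
      have h1 : [a] <+ X ++ N :: B := by simp [ha]
      have h2 : [N, c] <+ N :: Y := by simp [hc]
      simpa using h1.append h2
  · rintro ⟨h0, h1, h2, h3⟩ x y z hs hzx hxy
    have hm := mem_of3 hs
    have hle : ∀ a ∈ X ++ N :: (B ++ N :: Y), a ≤ N := by
      intro a ha
      simp at ha
      rcases ha with ha | ha | ha | ha | ha
      · exact (hX a ha).le
      · omega
      · exact (hB a ha).le
      · omega
      · exact (hY a ha).le
    have hy := hle y hm.2.1
    by_cases hyN : y = N
    · subst hyN
      have hx := hm.1
      have hz := hm.2.2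
      have hyX : y ∉ X := fun h => lt_irrefl _ (hX _ h)
      have hyB : y ∉ B := fun h => lt_irrefl _ (hB _ h)
      have hyY : y ∉ Y := fun h => lt_irrefl _ (hY _ h)
      have key : (x ∈ X ∧ z ∈ B) ∨ (x ∈ X ∧ z ∈ Y) ∨ (x ∈ B ∧ z ∈ Y) := by
        rcases sub3 hs with h' | ⟨h', h''⟩ | ⟨h', h''⟩ | h'
        · exact absurd (mem_of3 h').2.1 hyX
        · exact absurd (mem_of2 h').2 hyX
        · have : z ∈ B ∨ z ∈ Y := by
            have := (mem_of2 h'').2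
            have hzy : z ≠ y := by omega
            simpa [hzy] using this
          tauto
        · have hxy' : x ≠ y := by omega
          have h4 : [x,y,z] <+ B ++ y :: Y := by
            cases h' with
            | cons _ h => exact h
            | cons_cons _ h => exact absurd rfl hxy'
          rcases sub3 h4 with h' | ⟨h', h''⟩ | ⟨h', h''⟩ | h'
          · exact absurd (mem_of3 h').2.1 hyB
          · exact absurd (mem_of2 h').2 hyB
          · have := (mem_of2 h'').2
            have hzy : z ≠ y := by omega
            simp [hzy] at this
            tauto
          · cases h' with
            | cons _ h => exact absurd (mem_of3 h).2.1 hyY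
            | cons_cons _ h => exact absurd rfl hxy'
      rcases key with ⟨ha, hb⟩ | ⟨ha, hb⟩ | ⟨ha, hb⟩
      · have := h1 _ ha _ hb; omega
      · have := h2 _ ha _ hb; omega
      · have := h3 _ ha _ hb; omega
    · have := hs.filter (· ≠ N)
      rw [filt3 hX hB hY, filt (by simp; omega)] at this
      exact h0 _ _ _ this hzx hxy

lemma nn_ins {N : ℕ} {X B Y : List ℕ} (hX : ∀ a ∈ X, a < N) (hB : ∀ a ∈ B, a < N)
    (hY : ∀ a ∈ Y, a < N) : Nn (X ++ N :: (B ++ N :: Y)) ↔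
      Nn (X ++ (B ++ Y)) ∧ B.Nodup ∧ (∀ a ∈ X, a ∉ Y) := by
  constructor
  · intro H
    refine ⟨fun x y hs => H x y (hs.trans sub_ins), ?_, fun a ha hc => ?_⟩
    · rw [List.nodup_iff_sublist]
      intro a ha
      have h1 : a ∈ B := (mem_of2 ha).1
      have h2 := hB _ h1
      have := H N a (by
        have h1 : [N] ++ ([a,a] ++ [N]) <+ (N :: (B ++ N :: Y)) :=
          (((ha.append (by simp : [N] <+ N :: Y)))).cons_cons N
        exact h1.trans (sublist_append_right _ _))
      omega
    · have h2 := hX _ ha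
      have := H a N (by
        have h0 : [a] <+ X := by simpa
        have h3 : [N, a] <+ N :: Y := by simpa
        have h1 : [N,N,a] <+ (N :: (B ++ N :: Y)) :=
          (h3.trans (sublist_append_right B _)).cons_cons N
        simpa using h0.append h1)
      omega
  · rintro ⟨h0, h1, h2⟩ x y hs
    by_contra hxy
    have hNX : N ∉ X := fun h => lt_irrefl _ (hX _ h)
    have hNB : N ∉ B := fun h => lt_irrefl _ (hB _ h)
    have hNY : N ∉ Y := fun h => lt_irrefl _ (hY _ h)
    by_cases hx : x = N
    · subst hx
      have h3 : [x,y,y,x] <+ x :: (B ++ x :: Y) := by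
        rcases sub4 hs with h' | ⟨h', h''⟩ | ⟨h', h''⟩ | ⟨h', h''⟩ | h'
        · exact absurd (mem_of4 h').1 hNX
        · exact absurd (mem_of3 h').1 hNX
        · exact absurd (mem_of2 h').1 hNX
        · exact absurd h' hNX
        · exact h'
      have h4 : [y,y,x] <+ B ++ x :: Y := by simpa using h3
      rcases sub3 h4 with h' | ⟨h', h''⟩ | ⟨h', h''⟩ | h'
      · exact absurd (mem_of3 h').2.2 hNB
      · exact List.nodup_iff_sublist.1 h1 _ h'
      · cases h'' with
        | cons _ h => exact absurd (mem_of2 h).2 hNY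
        | cons_cons _ h => exact absurd rfl hxy
      · cases h' with
        | cons _ h => exact absurd (mem_of3 h).2.2 hNY
        | cons_cons _ h => exact absurd rfl hxy
    by_cases hy : y = N
    · subst hy
      have h3 : x ∈ X := by
        rcases sub4 hs with h' | ⟨h', h''⟩ | ⟨h', h''⟩ | ⟨h', h''⟩ | h'
        · exact (mem_of4 h').1
        · exact (mem_of3 h').1
        · exact (mem_of2 h').1
        · exact h'
        · exfalso
          have h4 : [x,y,y,x] <+ B ++ y :: Y := by
            cases h' with
            | cons _ h => exact h
            | cons_cons _ h => exact absurd rfl hxy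
          have := (h4.count_le y)
          simp [count_eq_zero_of_not_mem hNB, count_eq_zero_of_not_mem hNY, hxy] at this
      have h4 : x ∈ Y := by
        have e : X ++ y :: (B ++ y :: Y) = (X ++ y :: B) ++ y :: Y := by simp
        rw [e] at hs
        have hc : (X ++ y :: B).count y = 1 := by
          simp [count_eq_zero_of_not_mem hNB, count_eq_zero_of_not_mem hNX]
        rcases sub4 hs with h' | ⟨h', h''⟩ | ⟨h', h''⟩ | ⟨h', h''⟩ | h'
        · have := h'.count_le y
          simp [hxy, hc] at this
        · have := h'.count_le y
          simp [hxy, hc] at this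
        · have := (mem_of2 h'').2
          simpa [hxy] using this
        · have := (mem_of3 h'').2.2
          simpa [hxy] using this
        · have := (mem_of4 h').2.2.2
          simpa [hxy] using this
      exact h2 _ h3 h4
    · have := hs.filter (· ≠ N)
      rw [filt3 hX hB hY] at this
      simp [hx, hy] at this
      exact hxy (h0 _ _ this)

/-- swapping two adjacent letters in the middle. -/
lemma nn_swap {X Y : List ℕ} {a c : ℕ} (hac : a ≠ c) (haY : a ∉ Y) (hcX : c ∉ X)
    (h : Nn (X ++ ([a, c] ++ Y))) :
    Nn (X ++ ([c, a] ++ Y)) := by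
  intro x y hs
  by_contra hxy
  have gen : ∀ d, x ≠ d → y ≠ d → (d = a ∨ d = c) → False := by
    intro d h1 h2 hd
    have := hs.filter (· ≠ d)
    have e : (X ++ ([c, a] ++ Y)).filter (· ≠ d) = (X ++ ([a, c] ++ Y)).filter (· ≠ d) := by
      rcases hd with rfl | rfl <;> simp [filter_cons]
    rw [e] at this
    simp [h1, h2] at this
    exact hxy (h _ _ (Sublist.trans (by simpa using this) (filter_sublist (p := (· ≠ d)))))
  have hx : (x = a ∧ y = c) ∨ (x = c ∧ y = a) := by
    by_contra hh
    have g1 := gen a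
    have g2 := gen c
    grind
  rcases hx with ⟨rfl, rfl⟩ | ⟨rfl, rfl⟩
  · -- last letter x is in [c,a] part, so [x,y,y] in X ++ [y]
    have e : X ++ ([y, x] ++ Y) = (X ++ [y]) ++ (x :: Y) := by simp
    rw [e] at hs
    have hc : (X ++ [y]).count y = 1 := by simp [count_eq_zero_of_not_mem hcX]
    rcases sub4 hs with h' | ⟨h', h''⟩ | ⟨h', h''⟩ | ⟨h', h''⟩ | h'
    · have := h'.count_le y
      simp [hxy, hc] at this
    · have := h'.count_le y
      simp [hxy, hc] at this
    · cases h'' with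
      | cons _ h => exact haY (mem_of2 h).2
      | cons_cons _ h => exact absurd rfl hxy
    · cases h'' with
      | cons _ h => exact haY (mem_of3 h).2.2
      | cons_cons _ h => exact absurd rfl hxy
    · cases h' with
      | cons _ h => exact haY (mem_of4 h).1
      | cons_cons _ h => exact haY (mem_of3 h).2.2
  · -- x = c, y = a
    rcases sub4 hs with h' | ⟨h', h''⟩ | ⟨h', h''⟩ | ⟨h', h''⟩ | h'
    · exact hcX (mem_of4 h').1
    · exact hcX (mem_of3 h').1
    · exact hcX (mem_of2 h').1
    · exact hcX h'
    · have := h'.count_le y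
      simp [hxy, count_eq_zero_of_not_mem haY] at this

lemma nn_swap' {X Y : List ℕ} {a c : ℕ} (hac : a ≠ c) (haY : a ∉ Y) (hcX : c ∉ X)
    (h : Nn (X ++ ([c, a] ++ Y))) :
    Nn (X ++ ([a, c] ++ Y)) := by
  intro x y hs
  by_contra hxy
  have gen : ∀ d, x ≠ d → y ≠ d → (d = a ∨ d = c) → False := by
    intro d h1 h2 hd
    have := hs.filter (· ≠ d)
    have e : (X ++ ([a, c] ++ Y)).filter (· ≠ d) = (X ++ ([c, a] ++ Y)).filter (· ≠ d) := by
      rcases hd with rfl | rfl <;> simp [filter_cons]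
    rw [e] at this
    simp [h1, h2] at this
    exact hxy (h _ _ (Sublist.trans (by simpa using this) (filter_sublist (p := (· ≠ d)))))
  have hx : (x = a ∧ y = c) ∨ (x = c ∧ y = a) := by
    by_contra hh
    have g1 := gen a
    have g2 := gen c
    grind
  have e : X ++ ([a, c] ++ Y) = (X ++ [a]) ++ (c :: Y) := by simp
  rw [e] at hs
  have k1 : c ∉ X ++ [a] := by simp; exact ⟨hcX, hac.symm⟩
  have k2 : a ∉ c :: Y := by simp; exact ⟨hac, haY⟩
  rcases sub4 hs with h' | ⟨h', h''⟩ | ⟨h', h''⟩ | ⟨h', h''⟩ | h'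
  · have := mem_of4 h'; grind
  · have := mem_of3 h'; grind
  · have := mem_of2 h'; have := mem_of2 h''; grind
  · have := mem_of3 h''; grind
  · have := mem_of4 h'; grind

/-! ### Transfer between functions and lists -/

lemma sub3_ofFn {M : ℕ} (f : Fin M → ℕ) (x y z : ℕ) : [x,y,z] <+ List.ofFn f ↔
    ∃ i j k : Fin M, i < j ∧ j < k ∧ f i = x ∧ f j = y ∧ f k = z := by
  constructor
  · intro h
    obtain ⟨is, e, hp⟩ := List.sublist_eq_map_getElem h
    rcases is with _ | ⟨i, _ | ⟨j, _ | ⟨k, _ | ⟨_, _⟩⟩⟩⟩ <;> simp at e hp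
    exact ⟨⟨i, by simpa using i.2⟩, ⟨j, by simpa using j.2⟩, ⟨k, by simpa using k.2⟩,
      hp.1.1, hp.2, e.1.symm, e.2.1.symm, e.2.2.symm⟩
  · rintro ⟨i, j, k, hij, hjk, rfl, rfl, rfl⟩
    have := List.map_getElem_sublist (l := List.ofFn f)
      (is := [⟨i, by simp⟩, ⟨j, by simp⟩, ⟨k, by simp⟩])
      (by simp; exact ⟨⟨hij, hij.trans hjk⟩, hjk⟩)
    simpa using this

lemma sub4_ofFn {M : ℕ} (f : Fin M → ℕ) (x y z w : ℕ) : [x,y,z,w] <+ List.ofFn f ↔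
    ∃ i j k l : Fin M, i < j ∧ j < k ∧ k < l ∧ f i = x ∧ f j = y ∧ f k = z ∧ f l = w := by
  constructor
  · intro h
    obtain ⟨is, e, hp⟩ := List.sublist_eq_map_getElem h
    rcases is with _ | ⟨i, _ | ⟨j, _ | ⟨k, _ | ⟨l, _ | ⟨_, _⟩⟩⟩⟩⟩ <;> simp at e hp
    exact ⟨⟨i, by simpa using i.2⟩, ⟨j, by simpa using j.2⟩, ⟨k, by simpa using k.2⟩,
      ⟨l, by simpa using l.2⟩,
      hp.1.1, hp.2.1.1, hp.2.2, e.1.symm, e.2.1.symm, e.2.2.1.symm, e.2.2.2.symm⟩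
  · rintro ⟨i, j, k, l, hij, hjk, hkl, rfl, rfl, rfl, rfl⟩
    have := List.map_getElem_sublist (l := List.ofFn f)
      (is := [⟨i, by simp⟩, ⟨j, by simp⟩, ⟨k, by simp⟩, ⟨l, by simp⟩])
      (by simp; exact ⟨⟨hij, hij.trans hjk, hij.trans (hjk.trans hkl)⟩, ⟨hjk, hjk.trans hkl⟩, hkl⟩)
    simpa using this

lemma count_ofFn' {M : ℕ} (f : Fin M → ℕ) (v : ℕ) :
    (List.ofFn f).count v = (Finset.univ.filter fun i => f i = v).card := by
  have := Fin.card_filter_univ_eq_vector_get_eq_count v (List.Vector.ofFn f)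
  rw [List.Vector.toList_ofFn] at this
  rw [← this]
  congr 1
  ext i
  simp [eq_comm]

def L {n : ℕ} (π : Fin (2*n) → Fin n) : List ℕ := List.ofFn fun i => (π i : ℕ)

lemma L_inj {n : ℕ} : Function.Injective (L (n := n)) := by
  intro a b h
  have := List.ofFn_injective h
  funext i
  exact Fin.ext (congrFun this i)

lemma L_cnt {n : ℕ} (π : Fin (2*n) → Fin n) : Cnt n (L π) ↔ IsMultisetPerm π := by
  unfold Cnt L IsMultisetPerm
  simp only [count_ofFn']
  constructor
  · intro h v
    have := h v
    simp only [v.2, if_true] at this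
    refine Eq.trans ?_ this
    congr 1
    ext i
    simp [Fin.ext_iff]
  · intro h v
    split_ifs with hv
    · refine Eq.trans ?_ (h ⟨v, hv⟩)
      congr 1
      ext i
      simp [Fin.ext_iff]
    · rw [Finset.card_eq_zero, Finset.filter_eq_empty_iff]
      intro i _ e
      exact hv (e ▸ (π i).2)

lemma L_av {n : ℕ} (π : Fin (2*n) → Fin n) : Av (L π) ↔ Avoids231 π := by
  unfold Av L Avoids231
  simp only [sub3_ofFn]
  constructor
  · rintro h ⟨i, j, k, hij, hjk, h1, h2⟩
    exact h _ _ _ ⟨i, j, k, hij, hjk, rfl, rfl, rfl⟩ h1 h2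
  · rintro h _ _ _ ⟨i, j, k, hij, hjk, rfl, rfl, rfl⟩ h1 h2
    exact h ⟨i, j, k, hij, hjk, h1, h2⟩

lemma L_nn {n : ℕ} (π : Fin (2*n) → Fin n) : Nn (L π) ↔ NonNesting π := by
  unfold Nn L NonNesting
  simp only [sub4_ofFn]
  constructor
  · rintro h ⟨i, j, k, l, hij, hjk, hkl, h1, h2, h3⟩
    exact h3 (Fin.ext (h (π i) (π j) ⟨i, j, k, l, hij, hjk, hkl, rfl, rfl,
      by rw [h2], by rw [h1]⟩))
  · rintro h x y ⟨i, j, k, l, hij, hjk, hkl, h1, h2, h3, h4⟩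
    by_contra hne
    exact h ⟨i, j, k, l, hij, hjk, hkl, Fin.ext (by omega), Fin.ext (by omega),
      fun e => hne (by rw [← h1, ← h2, e])⟩

lemma Cnt.perm {k : ℕ} {l : List ℕ} (h : Cnt k l) : l ~ List.range k ++ List.range k := by
  rw [List.perm_iff_count]
  intro v
  rw [h v, List.count_append, List.count_range]
  split_ifs <;> rfl

lemma Cnt.length {k : ℕ} {l : List ℕ} (h : Cnt k l) : l.length = 2 * k := by
  rw [h.perm.length_eq]; simp; omega

lemma Cnt.mem {k : ℕ} {l : List ℕ} (h : Cnt k l) {v : ℕ} : v ∈ l ↔ v < k := by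
  rw [h.perm.mem_iff]; simp

lemma card_transfer {n : ℕ} (c : (Fin (2*n) → Fin n) → Prop) (d : List ℕ → Prop)
    (h : ∀ π, c π ↔ d (L π)) :
    Finite {l : List ℕ // G n l ∧ d l} ∧
    Nat.card {π : Fin (2*n) → Fin n // IsMultisetPerm π ∧ NonNesting π ∧ Avoids231 π ∧ c π} =
      Nat.card {l : List ℕ // G n l ∧ d l} := by
  let e : {π : Fin (2*n) → Fin n // IsMultisetPerm π ∧ NonNesting π ∧ Avoids231 π ∧ c π} →
      {l : List ℕ // G n l ∧ d l} := fun π => ⟨L π.1, ⟨(L_cnt _).2 π.2.1, (L_av _).2 π.2.2.2.1,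
        (L_nn _).2 π.2.2.1⟩, (h _).1 π.2.2.2.2⟩
  have hb : Function.Bijective e := by
    constructor
    · intro a b hab
      exact Subtype.ext (L_inj (congrArg Subtype.val hab))
    · rintro ⟨l, ⟨h1, h2, h3⟩, h4⟩
      have hl := h1.length
      let π : Fin (2*n) → Fin n := fun i => ⟨l[i.1]'(by omega), h1.mem.1 (List.getElem_mem _)⟩
      have hπ : L π = l := by
        apply List.ext_getElem
        · simp [L, hl]
        · intro i _ _
          simp [L, π]
      refine ⟨⟨π, (L_cnt _).1 (hπ ▸ h1), (L_nn _).1 (hπ ▸ h3), (L_av _).1 (hπ ▸ h2),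
        (h _).2 (hπ ▸ h4)⟩, Subtype.ext hπ⟩
  exact ⟨Finite.of_surjective e hb.2, Nat.card_congr (Equiv.ofBijective e hb)⟩

def PS (k : ℕ) : Type := {l : List ℕ // G k l}
def QS (k : ℕ) : Type := {l : List ℕ // G k (0 :: l)}
def RS (k : ℕ) : Type := {l : List ℕ // G k (l ++ [k-1])}

lemma pcard (n : ℕ) : Finite (PS n) ∧ pNN n = Nat.card (PS n) := by
  have := card_transfer (n := n) (fun _ => True) (fun _ => True) (by simp)
  simp only [and_true] at this
  exact this

lemma qcard (n : ℕ) : Finite (QS n) ∧ qNN n = Nat.card (QS n) := by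
  obtain ⟨h1, h2⟩ := card_transfer (n := n) FirstIsOne (fun l => ∃ t, l = 0 :: t) (by
    intro π
    rcases n with _ | n
    · simp [FirstIsOne, L]
    · unfold FirstIsOne L
      have : List.ofFn (fun i => (π i : ℕ)) = (π ⟨0, by omega⟩ : ℕ) ::
        List.ofFn (fun i : Fin (2*n+1) => (π i.succ : ℕ)) := List.ofFn_succ
      rw [this]
      constructor
      · rintro ⟨_, h⟩
        exact ⟨_, by rw [h]⟩
      · rintro ⟨t, h⟩
        exact ⟨Nat.succ_pos _, Fin.ext (List.cons.inj h).1⟩)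
  let e : QS n → {l : List ℕ // G n l ∧ ∃ t, l = 0 :: t} := fun l => ⟨0 :: l.1, l.2, _, rfl⟩
  have hb : Function.Bijective e := by
    constructor
    · intro a b hab
      have := congrArg Subtype.val hab
      simp [e] at this
      exact Subtype.ext this
    · rintro ⟨l, h, t, rfl⟩
      exact ⟨⟨t, h⟩, rfl⟩
  exact ⟨Finite.of_injective e hb.1, h2.trans (Nat.card_congr (Equiv.ofBijective e hb)).symm⟩

lemma rcard (n : ℕ) : Finite (RS n) ∧ rNN n = Nat.card (RS n) := by
  obtain ⟨h1, h2⟩ := card_transfer (n := n) LastIsMax (fun l => ∃ t, l = t ++ [n-1]) (by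
    intro π
    rcases n with _ | n
    · simp [LastIsMax, L]
    · unfold LastIsMax L
      have : List.ofFn (fun i => (π i : ℕ)) =
        List.ofFn (fun i : Fin (2*n+1) => (π i.castSucc : ℕ)) ++ [(π (Fin.last (2*n+1)) : ℕ)] :=
          (List.ofFn_succ_last (f := fun i => (π i : ℕ)))
      rw [this]
      constructor
      · rintro ⟨_, h⟩
        have h' : π (Fin.last (2*n+1)) = ⟨n + 1 - 1, by omega⟩ := h
        exact ⟨_, by rw [h']⟩
      · rintro ⟨t, h⟩
        have := (List.append_inj' h rfl).2
        exact ⟨Nat.succ_pos _, Fin.ext (List.cons.inj this).1⟩)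
  let e : RS n → {l : List ℕ // G n l ∧ ∃ t, l = t ++ [n-1]} := fun l => ⟨l.1 ++ [n-1], l.2, _, rfl⟩
  have hb : Function.Bijective e := by
    constructor
    · intro a b hab
      have := congrArg Subtype.val hab
      simp [e] at this
      exact Subtype.ext this
    · rintro ⟨l, h, t, rfl⟩
      exact ⟨⟨t, h⟩, rfl⟩
  exact ⟨Finite.of_injective e hb.1, h2.trans (Nat.card_congr (Equiv.ofBijective e hb)).symm⟩

/-! ### The decomposition -/

def sh (k : ℕ) (l : List ℕ) : List ℕ := l.map (· + k)

lemma sh_inj {k : ℕ} {l l' : List ℕ} (h : sh k l = sh k l') : l = l' :=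
  List.map_injective_iff.2 (add_left_injective k) h

lemma sh_mem {k : ℕ} {l : List ℕ} {v : ℕ} : v ∈ sh k l ↔ ∃ w ∈ l, w + k = v := by simp [sh]

lemma sh_count {k : ℕ} {l : List ℕ} (v : ℕ) : (sh k l).count (v + k) = l.count v :=
  List.count_map_of_injective _ _ (add_left_injective k) _

lemma sh_exists {k : ℕ} {l : List ℕ} (h : ∀ v ∈ l, k ≤ v) : ∃ l', sh k l' = l := by
  refine ⟨l.map (· - k), ?_⟩
  simp only [sh, List.map_map]
  conv_rhs => rw [← List.map_id l]
  apply List.map_congr_left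
  intro a ha
  have := h a ha
  simp; omega

lemma sh_av {k : ℕ} {l : List ℕ} : Av (sh k l) ↔ Av l := by
  constructor
  · intro h x y z hs h1 h2
    exact h (x+k) (y+k) (z+k) (hs.map (· + k)) (by omega) (by omega)
  · intro h x y z hs h1 h2
    obtain ⟨s, hs, e⟩ := List.sublist_map_iff.1 hs
    rcases s with _ | ⟨a, _ | ⟨b, _ | ⟨c, _ | ⟨d, s⟩⟩⟩⟩ <;> simp at e
    exact h a b c hs (by omega) (by omega)

lemma sh_nn {k : ℕ} {l : List ℕ} : Nn (sh k l) ↔ Nn l := by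
  constructor
  · intro h x y hs
    have := h (x+k) (y+k) (hs.map (· + k))
    omega
  · intro h x y hs
    obtain ⟨s, hs, e⟩ := List.sublist_map_iff.1 hs
    rcases s with _ | ⟨a, _ | ⟨b, _ | ⟨c, _ | ⟨d, _ | ⟨d', s⟩⟩⟩⟩⟩ <;> simp at e
    obtain ⟨rfl, rfl, e1, e2⟩ := e
    have e1 : b = c := by omega
    have e2 : a = d := by omega
    subst e1 e2
    rw [h _ _ hs]

/-- The word with the two copies of the maximum inserted. -/
def lst (N : ℕ) (X B Y : List ℕ) : List ℕ := X ++ N :: (B ++ N :: Y)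

lemma lst_cnt {N : ℕ} {X B Y : List ℕ} :
    Cnt (N+1) (lst N X B Y) ↔ Cnt N (X ++ (B ++ Y)) := by
  unfold Cnt lst
  refine forall_congr' fun v => ?_
  simp only [List.count_append, List.count_cons, beq_iff_eq]
  split_ifs <;> omega

lemma lst_G {N : ℕ} {X B Y : List ℕ} : G (N+1) (lst N X B Y) ↔
    G N (X ++ (B ++ Y)) ∧ B.Nodup ∧ (∀ a ∈ X, a ∉ Y) ∧
     (∀ a ∈ X, ∀ c ∈ B, a ≤ c) ∧ (∀ a ∈ X, ∀ c ∈ Y, a ≤ c) ∧ (∀ a ∈ B, ∀ c ∈ Y, a ≤ c) := by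
  unfold G
  rw [lst_cnt]
  by_cases hc : Cnt N (X ++ (B ++ Y))
  · have hX : ∀ a ∈ X, a < N := fun a ha => hc.mem.1 (by simp [ha])
    have hB : ∀ a ∈ B, a < N := fun a ha => hc.mem.1 (by simp [ha])
    have hY : ∀ a ∈ Y, a < N := fun a ha => hc.mem.1 (by simp [ha])
    unfold lst
    rw [av_ins hX hB hY, nn_ins hX hB hY]
    tauto
  · tauto

lemma cnt_append {k m : ℕ} {U V : List ℕ} (hU : Cnt k U) (hV : Cnt m V) :
    Cnt (k+m) (U ++ sh k V) := by
  intro v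
  rw [List.count_append, hU v]
  by_cases h : v < k
  · have : v ∉ sh k V := by rw [sh_mem]; rintro ⟨w, _, h⟩; omega
    rw [List.count_eq_zero_of_not_mem this]
    simp [h]; omega
  · obtain ⟨w, rfl⟩ : ∃ w, v = w + k := ⟨v - k, by omega⟩
    rw [sh_count, hV w]
    split_ifs <;> omega

lemma G_append {k m : ℕ} {U V : List ℕ} (hU : Cnt k U) (hV : Cnt m V) :
    G (k+m) (U ++ sh k V) ↔ G k U ∧ G m V := by
  have hlt : ∀ a ∈ U, ∀ c ∈ sh k V, a < c := by
    intro a ha c hc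
    have := hU.mem.1 ha
    obtain ⟨w, _, e⟩ := sh_mem.1 hc
    omega
  have h1 := cnt_append hU hV
  unfold G
  rw [av_append (fun a ha c hc => (hlt a ha c hc).le),
    nn_append (fun a ha hc => lt_irrefl _ (hlt a ha a hc)), sh_av, sh_nn]
  tauto

lemma cnt_split {N : ℕ} {U V : List ℕ} (h : Cnt N (U ++ V)) (hlt : ∀ a ∈ U, ∀ c ∈ V, a < c) :
    ∃ k m V', k + m = N ∧ Cnt k U ∧ V = sh k V' ∧ Cnt m V' := by
  have hmem : ∀ v, v ∈ U ∨ v ∈ V ↔ v < N := fun v => by rw [← h.mem, List.mem_append]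
  have hex : ∃ v, v ∉ U := ⟨N, fun hN => lt_irrefl _ ((hmem N).1 (Or.inl hN))⟩
  obtain ⟨k, hk, hmin⟩ : ∃ k, k ∉ U ∧ ∀ v < k, v ∈ U := by
    classical
    exact ⟨Nat.find hex, Nat.find_spec hex, fun v hv => by simpa using Nat.find_min hex hv⟩
  have hU : ∀ v, v ∈ U ↔ v < k := by
    intro v
    refine ⟨fun hv => ?_, hmin v⟩
    by_contra hvk
    have : v ≠ k := fun e => hk (e ▸ hv)
    have hvN := (hmem v).1 (Or.inl hv)
    rcases (hmem k).2 (by omega) with h1 | h1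
    · exact hk h1
    · have := hlt v hv k h1; omega
  have hkN : k ≤ N := by
    by_contra hh
    have := (hmem N).1 (Or.inl ((hU N).2 (by omega)))
    omega
  have hV : ∀ v ∈ V, k ≤ v := by
    intro v hv
    by_contra hh
    have := hlt v ((hU v).2 (by omega)) v hv
    omega
  obtain ⟨V', rfl⟩ := sh_exists hV
  refine ⟨k, N - k, V', by omega, ?_, rfl, ?_⟩
  · intro v
    have := h v
    rw [List.count_append] at this
    by_cases hv : v < k
    · have h2 : v ∉ sh k V' := fun h3 => by have := hV v h3; omega
      rw [List.count_eq_zero_of_not_mem h2, if_pos (by omega)] at this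
      simp [hv]; omega
    · simp only [hv, if_false]
      exact List.count_eq_zero_of_not_mem (by rw [hU]; exact hv)
  · intro v
    have := h (v + k)
    rw [List.count_append, sh_count, List.count_eq_zero_of_not_mem (by rw [hU]; omega)] at this
    split_ifs at this ⊢ <;> omega

lemma G_split {N : ℕ} {U V : List ℕ} (h : G N (U ++ V)) (hlt : ∀ a ∈ U, ∀ c ∈ V, a < c) :
    ∃ k m V', k + m = N ∧ G k U ∧ V = sh k V' ∧ G m V' := by
  obtain ⟨k, m, V', rfl, h1, rfl, h2⟩ := cnt_split h.1 hlt
  have := (G_append h1 h2).1 h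
  exact ⟨k, m, V', rfl, this.1, rfl, this.2⟩

lemma G_swap {N : ℕ} {X Y : List ℕ} {a c : ℕ} (hac : a ≠ c)
    (hX : ∀ x ∈ X, x ≤ a ∧ x ≤ c ∧ x ≠ c) (hY : ∀ x ∈ Y, c ≤ x ∧ a ≤ x ∧ x ≠ a)
    (h : G N (X ++ ([a, c] ++ Y))) : G N (X ++ ([c, a] ++ Y)) := by
  obtain ⟨h1, h2, h3⟩ := h
  refine ⟨?_, ?_, nn_swap hac (fun h => (hY _ h).2.2 rfl) (fun h => (hX _ h).2.2 rfl) h3⟩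
  · intro v
    rw [← h1 v]
    apply List.Perm.count_eq
    exact List.Perm.append_left X (List.Perm.swap _ _ _)
  · rw [av_append (by simp; grind), av_append (by simp; grind)] at h2 ⊢
    refine ⟨h2.1, fun x y z hs => ?_, h2.2.2⟩
    have := hs.length_le
    simp at this

lemma G_swap' {N : ℕ} {X Y : List ℕ} {a c : ℕ} (hac : a < c)
    (hX : ∀ x ∈ X, x ≤ a) (hY : ∀ x ∈ Y, c ≤ x)
    (hXY : ∀ x ∈ X, ∀ y ∈ Y, x < y) (ha : a ∈ X) (hc : c ∈ Y)
    (h : G N (X ++ ([c, a] ++ Y))) : G N (X ++ ([a, c] ++ Y)) := by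
  obtain ⟨h1, h2, h3⟩ := h
  refine ⟨?_, ?_, nn_swap' hac.ne (fun h => lt_irrefl _ (hXY _ ha _ h))
    (fun h => lt_irrefl _ (hXY _ h _ hc)) h3⟩
  · intro v
    rw [← h1 v]
    apply List.Perm.count_eq
    exact List.Perm.append_left X (List.Perm.swap _ _ _)
  · rw [av_append (by simp; grind), av_append (by simp; grind)] at h2 ⊢
    refine ⟨h2.1, fun x y z hs => ?_, h2.2.2⟩
    have := hs.length_le
    simp at this

/-- The first `N` is unambiguous. -/
lemma split_uniq {N : ℕ} : ∀ {X X' Z Z' : List ℕ}, N ∉ X → N ∉ X' →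
    X ++ N :: Z = X' ++ N :: Z' → X = X' ∧ Z = Z'
  | [], [], _, _, _, _, h => by simpa using h
  | [], b :: X', _, _, _, h2, h => by simp at h h2; tauto
  | a :: X, [], _, _, h1, _, h => by simp at h h1; grind
  | a :: X, b :: X', Z, Z', h1, h2, h => by
    simp at h h1 h2
    obtain ⟨e1, e2⟩ := split_uniq (by tauto) (by tauto) h.2
    exact ⟨by rw [h.1, e1], e2⟩

lemma lst_inj {N : ℕ} {X B Y X' B' Y' : List ℕ} (h1 : G (N+1) (lst N X B Y))
    (h2 : G (N+1) (lst N X' B' Y')) (e : lst N X B Y = lst N X' B' Y') :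
    X = X' ∧ B = B' ∧ Y = Y' := by
  have c1 := lst_cnt.1 h1.1
  have c2 := lst_cnt.1 h2.1
  have n1 : N ∉ X ++ (B ++ Y) := by rw [c1.mem]; omega
  have n2 : N ∉ X' ++ (B' ++ Y') := by rw [c2.mem]; omega
  simp at n1 n2
  obtain ⟨e1, e2⟩ := split_uniq n1.1 n2.1 e
  obtain ⟨e2, e3⟩ := split_uniq n1.2.1 n2.2.1 e2
  exact ⟨e1, e2, e3⟩

lemma lst_exists {N : ℕ} {l : List ℕ} (h : G (N+1) l) : ∃ X B Y, l = lst N X B Y := by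
  have hc := h.1 N
  simp at hc
  have hm : N ∈ l := h.1.mem.2 (by omega)
  obtain ⟨X, Z, rfl, hX⟩ := List.append_of_mem hm |>.elim fun s ⟨t, e⟩ =>
    (List.eq_append_cons_of_mem hm)
  have hZ : N ∈ Z := by
    rw [← List.count_pos_iff]
    simp [List.count_eq_zero_of_not_mem hX] at hc
    omega
  obtain ⟨B, Y, rfl, hB⟩ := List.eq_append_cons_of_mem hZ
  exact ⟨X, B, Y, rfl⟩

lemma sh_ge {k : ℕ} {l : List ℕ} {v : ℕ} (h : v ∈ sh k l) : k ≤ v := by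
  obtain ⟨w, _, e⟩ := sh_mem.1 h; omega

lemma r_pos {k : ℕ} {X : List ℕ} (h : G k (X ++ [k-1])) : 0 < k := by
  have := (h.1.mem (v := k - 1)).1 (by simp)
  omega

lemma r_mem {k : ℕ} {X : List ℕ} (h : G k (X ++ [k-1])) : ∀ a ∈ X, a < k :=
  fun _ ha => h.1.mem.1 (by simp [ha])

lemma sh_cons {k : ℕ} {Y : List ℕ} : sh k (0 :: Y) = k :: sh k Y := by simp [sh]

lemma kind0 {k m : ℕ} {X Y : List ℕ} (hX : G k X) (hY : G m Y) :
    G (k+m+1) (lst (k+m) X [] (sh k Y)) := by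
  rw [lst_G]
  have h1 : ∀ a ∈ X, a < k := fun a ha => hX.1.mem.1 ha
  have h2 : ∀ a ∈ sh k Y, k ≤ a := fun a ha => sh_ge ha
  have h3 := (G_append hX.1 hY.1).2 ⟨hX, hY⟩
  refine ⟨h3, by simp, ?_, by simp, ?_, by simp⟩
  · intro a ha hb; have := h1 a ha; have := h2 a hb; omega
  · intro a ha b hb; have := h1 a ha; have := h2 b hb; omega

lemma kind1 {k m : ℕ} {X Y : List ℕ} (hX : G k (X ++ [k-1])) (hY : G m Y) :
    G (k+m+1) (lst (k+m) X [k-1] (sh k Y)) := by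
  rw [lst_G]
  have h0 := r_pos hX
  have h1 := r_mem hX
  have h2 : ∀ a ∈ sh k Y, k ≤ a := fun a ha => sh_ge ha
  have h3 := (G_append hX.1 hY.1).2 ⟨hX, hY⟩
  refine ⟨by simpa using h3, by simp, ?_, ?_, ?_, ?_⟩
  · intro a ha hb; have := h1 a ha; have := h2 a hb; omega
  · intro a ha b hb; have := h1 a ha; simp at hb; omega
  · intro a ha b hb; have := h1 a ha; have := h2 b hb; omega
  · intro a ha b hb; simp at ha; have := h2 b hb; omega

lemma kind2 {k m : ℕ} {X Y : List ℕ} (hX : G k X) (hY : G m (0 :: Y)) :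
    G (k+m+1) (lst (k+m) X [k] (sh k Y)) := by
  rw [lst_G]
  have h1 : ∀ a ∈ X, a < k := fun a ha => hX.1.mem.1 ha
  have h2 : ∀ a ∈ sh k Y, k ≤ a := fun a ha => sh_ge ha
  have h3 := (G_append hX.1 hY.1).2 ⟨hX, hY⟩
  rw [sh_cons] at h3
  refine ⟨by simpa using h3, by simp, ?_, ?_, ?_, ?_⟩
  · intro a ha hb; have := h1 a ha; have := h2 a hb; omega
  · intro a ha b hb; have := h1 a ha; simp at hb; omega
  · intro a ha b hb; have := h1 a ha; have := h2 b hb; omega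
  · intro a ha b hb; simp at ha; have := h2 b hb; omega

lemma kind3 {k m : ℕ} {X Y : List ℕ} (hX : G k (X ++ [k-1])) (hY : G m (0 :: Y)) :
    G (k+m+1) (lst (k+m) X [k-1, k] (sh k Y)) := by
  rw [lst_G]
  have h0 := r_pos hX
  have h1 := r_mem hX
  have h2 : ∀ a ∈ sh k Y, k ≤ a := fun a ha => sh_ge ha
  have h3 := (G_append hX.1 hY.1).2 ⟨hX, hY⟩
  rw [sh_cons] at h3
  refine ⟨by simpa using h3, by simp; omega, ?_, ?_, ?_, ?_⟩
  · intro a ha hb; have := h1 a ha; have := h2 a hb; omega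
  · intro a ha b hb; have := h1 a ha; simp at hb; omega
  · intro a ha b hb; have := h1 a ha; have := h2 b hb; omega
  · intro a ha b hb; simp at ha; have := h2 b hb; omega

lemma kind4 {k m : ℕ} {X Y : List ℕ} (hX : G k (X ++ [k-1])) (hY : G m (0 :: Y)) :
    G (k+m+1) (lst (k+m) X [k, k-1] (sh k Y)) := by
  rw [lst_G]
  have h0 := r_pos hX
  have h1 := r_mem hX
  have h2 : ∀ a ∈ sh k Y, k ≤ a := fun a ha => sh_ge ha
  have h3 := (G_append hX.1 hY.1).2 ⟨hX, hY⟩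
  rw [sh_cons] at h3
  refine ⟨G_swap (by omega) ?_ ?_ (by simpa using h3), by simp; omega, ?_, ?_, ?_, ?_⟩
  · intro a ha; have := h1 a ha; omega
  · intro a ha; have := h2 a ha; omega
  · intro a ha hb; have := h1 a ha; have := h2 a hb; omega
  · intro a ha b hb; have := h1 a ha; simp at hb; omega
  · intro a ha b hb; have := h1 a ha; have := h2 b hb; omega
  · intro a ha b hb; simp at ha; have := h2 b hb; omega

/-- The possible shapes of the middle block. -/
lemma middle {N : ℕ} {X B Y : List ℕ} (hc : Cnt N (X ++ (B ++ Y))) (hB : B.Nodup)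
    (hXY : ∀ a ∈ X, a ∉ Y) (h1 : ∀ a ∈ X, ∀ c ∈ B, a ≤ c) (h3 : ∀ a ∈ B, ∀ c ∈ Y, a ≤ c) :
    B = [] ∨ (∃ a ∈ X, B = [a]) ∨ (∃ c ∈ Y, B = [c]) ∨
      (∃ a ∈ X, ∃ c ∈ Y, B = [a, c] ∨ B = [c, a]) := by
  have hor : ∀ b ∈ B, b ∈ X ∨ b ∈ Y := by
    intro b hb
    have e := hc b
    rw [if_pos (hc.mem.1 (by simp [hb])), List.count_append, List.count_append,
      List.count_eq_one_of_mem hB hb] at e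
    by_contra hh
    push Not at hh
    rw [List.count_eq_zero_of_not_mem hh.1, List.count_eq_zero_of_not_mem hh.2] at e
    omega
  have hXs : ∀ b ∈ B, ∀ b' ∈ B, b ∈ X → b' ∈ X → b = b' := fun b hb b' hb' hx hx' =>
    le_antisymm (h1 _ hx _ hb') (h1 _ hx' _ hb)
  have hYs : ∀ b ∈ B, ∀ b' ∈ B, b ∈ Y → b' ∈ Y → b = b' := fun b hb b' hb' hx hx' =>
    le_antisymm (h3 _ hb _ hx') (h3 _ hb' _ hx)
  rcases B with _ | ⟨b, _ | ⟨b', _ | ⟨b'', B⟩⟩⟩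
  · simp
  · have := hor b (by simp)
    grind
  · have e1 := hor b (by simp)
    have e2 := hor b' (by simp)
    have e3 := hXs b (by simp) b' (by simp)
    have e4 := hYs b (by simp) b' (by simp)
    have : b ≠ b' := by simp at hB; tauto
    grind
  · exfalso
    have e1 := hor b (by simp)
    have e2 := hor b' (by simp)
    have e3 := hor b'' (by simp)
    have f1 := hXs b (by simp) b' (by simp)
    have f2 := hYs b (by simp) b' (by simp)
    have f3 := hXs b (by simp) b'' (by simp)
    have f4 := hYs b (by simp) b'' (by simp)
    have f5 := hXs b' (by simp) b'' (by simp)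
    have f6 := hYs b' (by simp) b'' (by simp)
    have g1 : b ≠ b' ∧ b ≠ b'' ∧ b' ≠ b'' := by simp at hB; tauto
    clear hor hXs hYs h1 h3 hXY hc hB
    rcases e1 with i1 | i1 <;> rcases e2 with i2 | i2 <;> rcases e3 with i3 | i3 <;>
    first
    | exact g1.1 (f1 i1 i2)
    | exact g1.1 (f2 i1 i2)
    | exact g1.2.1 (f3 i1 i3)
    | exact g1.2.1 (f4 i1 i3)
    | exact g1.2.2 (f5 i2 i3)
    | exact g1.2.2 (f6 i2 i3)

lemma last_eq {k a : ℕ} {X : List ℕ} (h : G k (X ++ [a])) (hX : ∀ x ∈ X, x ≤ a) : a = k - 1 := by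
  have h1 := (h.1.mem (v := a)).1 (by simp)
  have h2 := h.1.mem.2 (show k - 1 < k by omega)
  simp at h2
  rcases h2 with h2 | h2
  · have := hX _ h2; omega
  · omega

lemma first_eq {m k c : ℕ} {Y V : List ℕ} (h : G m V) (e : c :: Y = sh k V)
    (hY : ∀ x ∈ Y, c ≤ x) : c = k ∧ ∃ Y', V = 0 :: Y' ∧ Y = sh k Y' := by
  rcases V with _ | ⟨v, V⟩
  · simp [sh] at e
  · have e' : c = v + k ∧ Y = sh k V := by simpa [sh] using e
    have h1 := (h.1.mem (v := v)).1 (by simp)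
    have h2 := h.1.mem.2 (show 0 < m by omega)
    have : v = 0 := by
      simp at h2
      rcases h2 with h2 | h2
      · exact h2.symm
      · have := hY (0 + k) (by rw [e'.2, sh_mem]; exact ⟨0, h2, rfl⟩)
        omega
    subst this
    exact ⟨by omega, V, rfl, e'.2⟩

lemma lst_cases {N : ℕ} {X B Y : List ℕ} (h : G (N+1) (lst N X B Y)) :
    ∃ k m Y', k + m = N ∧ Y = sh k Y' ∧
     ((B = [] ∧ G k X ∧ G m Y') ∨
      (B = [k-1] ∧ G k (X ++ [k-1]) ∧ G m Y') ∨
      (B = [k] ∧ G k X ∧ G m (0 :: Y')) ∨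
      (B = [k-1, k] ∧ G k (X ++ [k-1]) ∧ G m (0 :: Y')) ∨
      (B = [k, k-1] ∧ G k (X ++ [k-1]) ∧ G m (0 :: Y'))) := by
  obtain ⟨hG, hB, hXY, h1, h2, h3⟩ := lst_G.1 h
  have hXY' : ∀ a ∈ X, ∀ c ∈ Y, a < c := fun a ha c hc =>
    lt_of_le_of_ne (h2 a ha c hc) (fun e => hXY a ha (e ▸ hc))
  rcases middle hG.1 hB hXY h1 h3 with rfl | ⟨a, ha, rfl⟩ | ⟨c, hc, rfl⟩ | ⟨a, ha, c, hc, hBe⟩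
  · obtain ⟨k, m, V, e, g1, rfl, g2⟩ := G_split (U := X) (V := Y) (by simpa using hG) hXY'
    exact ⟨k, m, V, e, rfl, Or.inl ⟨rfl, g1, g2⟩⟩
  · obtain ⟨k, m, V, e, g1, rfl, g2⟩ := G_split (U := X ++ [a]) (V := Y) (by simpa using hG)
      (by
        intro x hx
        simp at hx
        rcases hx with hx | rfl
        · exact hXY' x hx
        · exact hXY' x ha)
    have := last_eq g1 (fun x hx => h1 x hx a (by simp))
    subst this
    exact ⟨k, m, V, e, rfl, Or.inr (Or.inl ⟨rfl, g1, g2⟩)⟩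
  · obtain ⟨k, m, V, e, g1, e2, g2⟩ := G_split (U := X) (V := c :: Y) (by simpa using hG)
      (by
        intro x hx y hy
        simp at hy
        rcases hy with rfl | hy
        · exact hXY' x hx y hc
        · exact hXY' x hx y hy)
    obtain ⟨rfl, V, rfl, rfl⟩ := first_eq g2 e2 (fun x hx => h3 c (by simp) x hx)
    exact ⟨_, m, V, e, rfl, Or.inr (Or.inr (Or.inl ⟨rfl, g1, g2⟩))⟩
  · have hac := hXY' a ha c hc
    have hXa : ∀ x ∈ X, x ≤ a := fun x hx => h1 x hx a (by rcases hBe with rfl | rfl <;> simp)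
    have hYc : ∀ x ∈ Y, c ≤ x := fun x hx => h3 c (by rcases hBe with rfl | rfl <;> simp) x hx
    have hG' : G N (X ++ ([a, c] ++ Y)) := by
      rcases hBe with rfl | rfl
      · exact hG
      · exact G_swap' (by omega) hXa hYc hXY' ha hc hG
    obtain ⟨k, m, V, e, g1, e2, g2⟩ := G_split (U := X ++ [a]) (V := c :: Y) (by simpa using hG')
      (by
        intro x hx y hy
        simp at hx hy
        rcases hx with hx | rfl <;> rcases hy with rfl | hy
        · exact hXY' x hx y hc
        · exact hXY' x hx y hy
        · exact hac
        · exact hXY' x ha y hy)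
    have := last_eq g1 hXa
    subst this
    obtain ⟨rfl, V, rfl, rfl⟩ := first_eq g2 e2 hYc
    refine ⟨_, m, V, e, rfl, Or.inr (Or.inr (Or.inr ?_))⟩
    rcases hBe with rfl | rfl
    · exact Or.inl ⟨rfl, g1, g2⟩
    · exact Or.inr ⟨rfl, g1, g2⟩

abbrev Ty (N : ℕ) : Type := Σ k : Fin (N+1),
  (PS k × PS (N - k)) ⊕ (RS k × PS (N - k)) ⊕ (PS k × QS (N - k)) ⊕
    (RS k × QS (N - k)) ⊕ (RS k × QS (N - k))

def FX {N : ℕ} : Ty N → List ℕ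
  | ⟨_, .inl s⟩ => s.1.1
  | ⟨_, .inr (.inl s)⟩ => s.1.1
  | ⟨_, .inr (.inr (.inl s))⟩ => s.1.1
  | ⟨_, .inr (.inr (.inr (.inl s)))⟩ => s.1.1
  | ⟨_, .inr (.inr (.inr (.inr s)))⟩ => s.1.1

def FB {N : ℕ} : Ty N → List ℕ
  | ⟨_, .inl _⟩ => []
  | ⟨k, .inr (.inl _)⟩ => [k - 1]
  | ⟨k, .inr (.inr (.inl _))⟩ => [k]
  | ⟨k, .inr (.inr (.inr (.inl _)))⟩ => [k - 1, k]
  | ⟨k, .inr (.inr (.inr (.inr _)))⟩ => [k, k - 1]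

def FY {N : ℕ} : Ty N → List ℕ
  | ⟨k, .inl s⟩ => sh k s.2.1
  | ⟨k, .inr (.inl s)⟩ => sh k s.2.1
  | ⟨k, .inr (.inr (.inl s))⟩ => sh k s.2.1
  | ⟨k, .inr (.inr (.inr (.inl s)))⟩ => sh k s.2.1
  | ⟨k, .inr (.inr (.inr (.inr s)))⟩ => sh k s.2.1

lemma F_good {N : ℕ} (t : Ty N) : G (N+1) (lst N (FX t) (FB t) (FY t)) := by
  obtain ⟨⟨k, hk⟩, s⟩ := t
  have e : k + (N - k) = N := by omega
  rcases s with ⟨X, Y⟩ | ⟨X, Y⟩ | ⟨X, Y⟩ | ⟨X, Y⟩ | ⟨X, Y⟩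
  · have := kind0 X.2 Y.2
    simp only [e] at this
    exact this
  · have := kind1 X.2 Y.2
    simp only [e] at this
    exact this
  · have := kind2 X.2 Y.2
    simp only [e] at this
    exact this
  · have := kind3 X.2 Y.2
    simp only [e] at this
    exact this
  · have := kind4 X.2 Y.2
    simp only [e] at this
    exact this

lemma P_len {k : ℕ} (X : PS k) : X.1.length = 2 * k := X.2.1.length
lemma R_len {k : ℕ} (X : RS k) : X.1.length + 1 = 2 * k := by
  have := X.2.1.length
  simpa using this

lemma F_inj {N : ℕ} (t t' : Ty N) (hX : FX t = FX t') (hB : FB t = FB t') (hY : FY t = FY t') :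
    t = t' := by
  obtain ⟨⟨k, hk⟩, s⟩ := t
  obtain ⟨⟨k', hk'⟩, s'⟩ := t'
  have hkk : k = k' := by
    have hl := congrArg List.length hX
    rcases s with ⟨X, Y⟩ | ⟨X, Y⟩ | ⟨X, Y⟩ | ⟨X, Y⟩ | ⟨X, Y⟩ <;>
    rcases s' with ⟨X', Y'⟩ | ⟨X', Y'⟩ | ⟨X', Y'⟩ | ⟨X', Y'⟩ | ⟨X', Y'⟩ <;>
    simp only [FX] at hl <;>
    first
    | (have h1 := P_len X; have h2 := P_len X'; simp only at h1 h2; omega)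
    | (have h1 := R_len X; have h2 := P_len X'; simp only at h1 h2; omega)
    | (have h1 := P_len X; have h2 := R_len X'; simp only at h1 h2; omega)
    | (have h1 := R_len X; have h2 := R_len X'; simp only at h1 h2; omega)
  subst hkk
  have hl := congrArg List.length hX
  rcases s with ⟨X, Y⟩ | ⟨X, Y⟩ | ⟨X, Y⟩ | ⟨X, Y⟩ | ⟨X, Y⟩ <;>
  rcases s' with ⟨X', Y'⟩ | ⟨X', Y'⟩ | ⟨X', Y'⟩ | ⟨X', Y'⟩ | ⟨X', Y'⟩ <;>
  simp only [FX] at hl hX <;>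
  simp only [FY] at hY <;>
  first
  | (have h1 := Subtype.ext hX
     have h2 := Subtype.ext (sh_inj hY)
     subst h1 h2
     rfl)
  | (exfalso; simp [FB] at hB; done)
  | (exfalso; have h1 := R_len X; have h2 := P_len X'; simp only at h1 h2; omega)
  | (exfalso; have h1 := P_len X; have h2 := R_len X'; simp only at h1 h2; omega)
  | (exfalso; have h1 := R_len X; simp [FB] at hB; simp only at h1; omega)

lemma F_surj {N : ℕ} {l : List ℕ} (h : G (N+1) l) : ∃ t : Ty N, lst N (FX t) (FB t) (FY t) = l := by
  obtain ⟨X, B, Y, rfl⟩ := lst_exists h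
  obtain ⟨k, m, Y', e, rfl, hh⟩ := lst_cases h
  obtain rfl : m = N - k := by omega
  rcases hh with ⟨rfl, h1, h2⟩ | ⟨rfl, h1, h2⟩ | ⟨rfl, h1, h2⟩ | ⟨rfl, h1, h2⟩ | ⟨rfl, h1, h2⟩
  · exact ⟨⟨⟨k, by omega⟩, .inl (⟨X, h1⟩, ⟨Y', h2⟩)⟩, rfl⟩
  · exact ⟨⟨⟨k, by omega⟩, .inr (.inl (⟨X, h1⟩, ⟨Y', h2⟩))⟩, rfl⟩
  · exact ⟨⟨⟨k, by omega⟩, .inr (.inr (.inl (⟨X, h1⟩, ⟨Y', h2⟩)))⟩, rfl⟩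
  · exact ⟨⟨⟨k, by omega⟩, .inr (.inr (.inr (.inl (⟨X, h1⟩, ⟨Y', h2⟩))))⟩, rfl⟩
  · exact ⟨⟨⟨k, by omega⟩, .inr (.inr (.inr (.inr (⟨X, h1⟩, ⟨Y', h2⟩))))⟩, rfl⟩

lemma main (N : ℕ) : pNN (N+1) = ∑ k ∈ Finset.range (N+1),
    (pNN k * pNN (N-k) + (rNN k * pNN (N-k) + (pNN k * qNN (N-k) +
      (rNN k * qNN (N-k) + rNN k * qNN (N-k))))) := by
  have hP := fun k => (pcard k).1
  have hQ := fun k => (qcard k).1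
  have hR := fun k => (rcard k).1
  let F : Ty N → PS (N+1) := fun t => ⟨lst N (FX t) (FB t) (FY t), F_good t⟩
  have hb : Function.Bijective F := by
    constructor
    · intro t t' e
      obtain ⟨a, b, c⟩ := lst_inj (F_good t) (F_good t') (congrArg Subtype.val e)
      exact F_inj _ _ a b c
    · rintro ⟨l, hl⟩
      obtain ⟨t, ht⟩ := F_surj hl
      exact ⟨t, Subtype.ext ht⟩
  rw [(pcard _).2, ← Nat.card_congr (Equiv.ofBijective F hb), Nat.card_sigma, Finset.sum_range]
  refine Finset.sum_congr rfl fun k _ => ?_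
  simp only [Nat.card_sum, Nat.card_prod, (pcard _).2, (qcard _).2, (rcard _).2]

lemma q_zero : qNN 0 = 0 := by
  rw [(qcard 0).2]
  have : IsEmpty (QS 0) := ⟨fun l => by have := l.2.1.length; simp at this⟩
  simp

lemma r_zero : rNN 0 = 0 := by
  rw [(rcard 0).2]
  have : IsEmpty (RS 0) := ⟨fun l => by have := l.2.1.length; simp at this⟩
  simp

end W

theorem stmt7 (n : ℕ) (hn : 3 ≤ n) :
    pNN n =
      2 * (∑ k ∈ Finset.Icc 1 (n-2), rNN k * qNN (n-k-1)) +
      (∑ k ∈ Finset.range (n-1), pNN k * qNN (n-k-1)) +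
      (∑ k ∈ Finset.Icc 1 (n-1), rNN k * pNN (n-k-1)) +
      (∑ k ∈ Finset.range n, pNN k * pNN (n-k-1)) := by

  obtain ⟨N, rfl⟩ : ∃ N, n = N + 2 := ⟨n - 2, by omega⟩
  have e : ∀ k, N + 2 - k - 1 = N + 1 - k := fun k => by omega
  have hr : ∀ (M : ℕ) (f : ℕ → ℕ), f 0 = 0 →
      ∑ k ∈ Finset.Icc 1 M, f k = ∑ k ∈ Finset.range (M+1), f k := by
    intro M f hf
    rw [Finset.sum_range_succ', hf, add_zero,
      show Finset.Icc 1 M = Finset.Ico 1 (M+1) by ext; simp, Finset.sum_Ico_eq_sum_range]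
    simp [add_comm]
  have hq : ∀ g : ℕ → ℕ, ∑ k ∈ Finset.range (N+2), g k * qNN (N+1-k) =
      ∑ k ∈ Finset.range (N+1), g k * qNN (N+1-k) := by
    intro g
    rw [Finset.sum_range_succ]
    simp [W.q_zero]
  simp only [e]
  rw [hr _ _ (by simp [W.r_zero]), hr _ _ (by simp [W.r_zero])]
  have e1 : N + 2 - 2 + 1 = N + 1 := by omega
  have e2 : N + 2 - 1 = N + 1 := by omega
  rw [e1, e2, ← hq, ← hq, W.main (N+1)]
  simp only [Finset.sum_add_distrib]
  ring
end

section
/- Let q̄_n denote the number of non-crossing 231-avoiding permutations of {1,1,...,n,n} whose first entry is 1, and let p̄_n denote the number of all non-crossing 231-avoiding permutations of {1,1,...,n,n}, with p̄_0 = 1. Then for all n ≥ 1, q̄_n = Σ over all compositions (x_1,...,x_k) of n of the product p̄_{x_1-1}·p̄_{x_2-1}···p̄_{x_k-1}. -/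
noncomputable def pbar (n : ℕ) : ℕ :=
  Nat.card {π : Fin (2*n) → Fin n // IsMultisetPerm π ∧ NonCrossing π ∧ Avoids231 π}

noncomputable def qbar (n : ℕ) : ℕ :=
  Nat.card {π : Fin (2*n) → Fin n //
    IsMultisetPerm π ∧ NonCrossing π ∧ Avoids231 π ∧ FirstIsOne π}


namespace NCW

open List

/-- Non-crossing words. -/
def NC (l : List ℕ) : Prop := ∀ a b, a ≠ b → ¬ [a, b, a, b] <+ l

/-- 231-avoiding words. -/
def AV (l : List ℕ) : Prop := ∀ a b c, c < a → a < b → ¬ [a, b, c] <+ l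

/-- Good words on the letters `a, ..., a+m-1`, each used twice. -/
def W (a m : ℕ) (l : List ℕ) : Prop :=
  (∀ v, l.count v = if a ≤ v ∧ v < a + m then 2 else 0) ∧ NC l ∧ AV l

/-- Good words that are empty or start with `0`. -/
def Q (m : ℕ) (l : List ℕ) : Prop := W 0 m l ∧ ∀ x ∈ l.head?, x = 0

/-- The gluing map. -/
def G (m : ℕ) (s t : List ℕ) : List ℕ := s.take 1 ++ m :: m :: (s.drop 1 ++ t)

theorem NC.sub {l l' : List ℕ} (h : NC l) (s : l' <+ l) : NC l' :=
  fun a b hab h' => h a b hab (h'.trans s)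

theorem AV.sub {l l' : List ℕ} (h : AV l) (s : l' <+ l) : AV l' :=
  fun a b c h1 h2 h' => h a b c h1 h2 (h'.trans s)

theorem W.mem {a m : ℕ} {l : List ℕ} (h : W a m l) (v : ℕ) : v ∈ l ↔ a ≤ v ∧ v < a + m := by
  rw [← List.count_pos_iff, h.1 v]; split_ifs <;> simp_all

theorem pair_app {x y : ℕ} {u v : List ℕ} (h : [x, y] <+ u ++ v) :
    [x, y] <+ u ∨ (x ∈ u ∧ y ∈ v) ∨ [x, y] <+ v := by
  induction u with
  | nil => simp_all
  | cons b u ih =>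
    rw [List.cons_append, List.cons_sublist_cons'] at h
    rcases h with h | ⟨rfl, h⟩
    · rcases ih h with h | h | h
      · exact Or.inl (h.cons _)
      · exact Or.inr (Or.inl ⟨by simp [h.1], h.2⟩)
      · exact Or.inr (Or.inr h)
    · simp only [List.singleton_sublist, List.mem_append] at h
      rcases h with h | h
      · left; simpa using h
      · right; left; simpa using h

theorem skip {x : ℕ} {s u v : List ℕ} (h : x :: s <+ u ++ v) (hx : x ∉ u) : x :: s <+ v := by
  induction u with
  | nil => simpa using h
  | cons b u ih =>
    rw [List.cons_append, List.cons_sublist_cons'] at h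
    simp only [List.mem_cons, not_or] at hx
    rcases h with h | ⟨rfl, h⟩
    · exact ih h hx.2
    · exact absurd rfl hx.1

theorem split_filter (m : ℕ) (r : List ℕ) (hm : m ∉ r)
    (h : ∀ y z, z < m → m < y → ¬ [y, z] <+ r) :
    r = r.filter (· < m) ++ r.filter (m < ·) := by
  induction r with
  | nil => simp
  | cons x r ih =>
    simp only [List.mem_cons, not_or] at hm
    have ih' := ih hm.2 (fun y z h1 h2 h3 => h y z h1 h2 (h3.cons _))
    rcases lt_or_gt_of_ne hm.1 with hx | hx
    · have h0 : r.filter (· < m) = [] := by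
        rw [List.filter_eq_nil_iff]
        intro z hz hzm
        exact h x z (by simpa using hzm) hx (by simpa using hz)
      have h1 : ¬ x < m := by omega
      rw [h0] at ih'
      simp only [List.nil_append] at ih'
      simp [h0, h1, hx, ← ih']
    · have h1 : ¬ m < x := by omega
      simp [h1, hx, ← ih']

section glue
variable {m k : ℕ} {s t : List ℕ}

theorem G_get (hs : Q m s) : (G m s t).getD 1 0 = m := by
  rcases s with _ | ⟨x, s⟩ <;> simp [G]

theorem G_lt (hs : Q m s) (ht : W (m + 1) k t) : (G m s t).filter (· < m) = s := by
  have h1 : ∀ x ∈ s, x < m := fun x hx => by have := (hs.1.mem x).1 hx; omega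
  have h2 : t.filter (· < m) = [] := by
    rw [List.filter_eq_nil_iff]; intro x hx; have := (ht.mem x).1 hx; simp; omega
  have h3 : ∀ s' : List ℕ, s' <+ s → s'.filter (· < m) = s' := fun s' h => by
    rw [List.filter_eq_self]; intro x hx; simpa using h1 x (h.subset hx)
  simp only [G, List.filter_append, List.filter_cons, h2, h3 _ (List.take_sublist 1 s),
    h3 _ (List.drop_sublist 1 s)]
  simp only [lt_irrefl, decide_false, Bool.false_eq_true, if_false, List.append_nil]
  exact List.take_append_drop 1 s

theorem G_gt (hs : Q m s) (ht : W (m + 1) k t) : (G m s t).filter (m < ·) = t := by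
  have h1 : ∀ x ∈ s, x < m := fun x hx => by have := (hs.1.mem x).1 hx; omega
  have h2 : t.filter (m < ·) = t := by
    rw [List.filter_eq_self]; intro x hx; have := (ht.mem x).1 hx; simp; omega
  have h3 : ∀ s' : List ℕ, s' <+ s → s'.filter (m < ·) = [] := fun s' h => by
    rw [List.filter_eq_nil_iff]; intro x hx; have := h1 x (h.subset hx); simp; omega
  simp only [G, List.filter_append, List.filter_cons, h2, h3 _ (List.take_sublist 1 s),
    h3 _ (List.drop_sublist 1 s)]
  simp

theorem G_count (v : ℕ) : (G m s t).count v = s.count v + t.count v + if v = m then 2 else 0 := by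
  have : s.count v = (s.take 1).count v + (s.drop 1).count v := by
    rw [← List.count_append, List.take_append_drop]
  simp only [G, List.count_append, List.count_cons, this]
  by_cases h : v = m
  · subst h; simp; omega
  · have : ¬ m = v := fun e => h e.symm
    simp [h, this]; omega

theorem G_Q (hs : Q m s) (ht : W (m + 1) k t) : Q (m + 1 + k) (G m s t) := by
  have h1 : ∀ x ∈ s, x < m := fun x hx => by have := (hs.1.mem x).1 hx; omega
  have h2 : ∀ x ∈ t, m < x := fun x hx => by have := (ht.mem x).1 hx; omega
  have h0 : ∀ x ∈ s.take 1, x = 0 := by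
    intro x hx
    rcases s with _ | ⟨y, s⟩
    · simp at hx
    · have := hs.2 y (by simp); simp at hx; omega
  have hu : m ∉ s.take 1 := fun h => by have := h1 m (List.mem_of_mem_take h); omega
  have hd : m ∉ s.drop 1 ++ t := fun h => by
    rcases List.mem_append.1 h with h | h
    · have := h1 m (List.mem_of_mem_drop h); omega
    · have := h2 m h; omega
  have hA : ∀ b, b ≠ m → ¬ [m, b, m] <+ G m s t := by
    intro b hb h
    have h := skip h hu
    rw [List.cons_sublist_cons', List.cons_sublist_cons'] at h
    rcases h with (h | ⟨_, h⟩) | ⟨_, h⟩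
    · exact hd (h.subset (by simp))
    · exact hd (h.subset (by simp))
    · rw [List.cons_sublist_cons'] at h
      rcases h with h | ⟨h, _⟩
      · exact hd (h.subset (by simp))
      · exact hb h
  have hB : ∀ y z, m < y → z < m → ¬ [y, z] <+ G m s t := by
    intro y z hy hz h
    have e : G m s t = (s.take 1 ++ m :: m :: s.drop 1) ++ t := by simp [G]
    have hX : ∀ x ∈ s.take 1 ++ m :: m :: s.drop 1, x ≤ m := by
      intro x hx
      simp only [List.mem_append, List.mem_cons] at hx
      rcases hx with h | h | h | h
      · exact (h1 x (List.mem_of_mem_take h)).le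
      · exact h.le
      · exact h.le
      · exact (h1 x (List.mem_of_mem_drop h)).le
    rw [e] at h
    rcases pair_app h with h | h | h
    · have := hX y (h.subset (by simp)); omega
    · have := hX y h.1; omega
    · have := h2 z (h.subset (by simp)); omega
  have hC : ∀ a, a ≠ m → [a, m] <+ G m s t → a = 0 := by
    intro a ha h
    rcases pair_app h with h | h | h
    · exact absurd (h.subset (by simp)) hu
    · exact h0 a h.1
    · rw [List.cons_sublist_cons', List.cons_sublist_cons'] at h
      rcases h with (h | ⟨h, _⟩) | ⟨h, _⟩
      · exact absurd (h.subset (by simp)) hd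
      · exact absurd h ha
      · exact absurd h ha
  refine ⟨⟨?_, ?_, ?_⟩, ?_⟩
  · intro v
    rw [G_count, hs.1.1, ht.1]
    split_ifs <;> omega
  · intro a b hab h
    have hlt := h.filter (· < m)
    have hgt := h.filter (m < ·)
    rw [G_lt hs ht] at hlt
    rw [G_gt hs ht] at hgt
    rcases lt_trichotomy a m with ha | rfl | ha
    · rcases lt_trichotomy b m with hb | rfl | hb
      · exact hs.1.2.1 a b hab (by simpa [ha, hb] using hlt)
      · refine hA a hab (Sublist.trans ?_ h); simp
      · refine hB b a hb ha (Sublist.trans ?_ h)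
        exact (List.Sublist.cons _ (by simp))
    · refine hA b hab.symm (Sublist.trans ?_ h)
      exact List.sublist_append_left [a, b, a] [b]
    · rcases lt_trichotomy b m with hb | rfl | hb
      · refine hB a b ha hb (Sublist.trans ?_ h)
        exact List.sublist_append_left [a, b] [a, b]
      · refine hA a hab (Sublist.trans ?_ h); simp
      · exact ht.2.1 a b hab (by simpa [ha, hb] using hgt)
  · intro a b c hca hab h
    have hlt := h.filter (· < m)
    have hgt := h.filter (m < ·)
    rw [G_lt hs ht] at hlt
    rw [G_gt hs ht] at hgt
    have hbc : [b, c] <+ G m s t := Sublist.trans (by simp) h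
    have hab' : [a, b] <+ G m s t := Sublist.trans (List.sublist_append_left [a, b] [c]) h
    rcases lt_trichotomy b m with hb | rfl | hb
    · have ha : a < m := by omega
      have hc : c < m := by omega
      exact hs.1.2.2 a b c hca hab (by simpa [ha, hb, hc] using hlt)
    · have := hC a (by omega) hab'; omega
    · rcases lt_trichotomy c m with hc | rfl | hc
      · exact hB b c hb hc hbc
      · have := hC b (by omega) hbc; omega
      · have ha : m < a := by omega
        exact ht.2.2 a b c hca hab (by simpa [ha, hb, hc] using hgt)
  · rcases s with _ | ⟨y, s⟩
    · have : m = 0 := by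
        by_contra hm
        have := (hs.1.mem 0).2 (by omega)
        simp at this
      simp [G, this]
    · simpa [G] using hs.2

end glue

theorem count_filter_lt (l : List ℕ) (p : ℕ → Bool) (v : ℕ) :
    (l.filter p).count v = if p v then l.count v else 0 := by
  split_ifs with h
  · exact List.count_filter h
  · rw [List.count_eq_zero]; intro hm; exact h (List.mem_filter.1 hm).2

theorem G_surj {n : ℕ} (hn : 1 ≤ n) {l : List ℕ} (hl : Q n l) :
    ∃ m s t, m < n ∧ Q m s ∧ W (m + 1) (n - m - 1) t ∧ G m s t = l := by
  obtain ⟨⟨hc, hnc, hav⟩, hh⟩ := hl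
  have hW : W 0 n l := ⟨hc, hnc, hav⟩
  rcases l with _ | ⟨x, _ | ⟨m, r⟩⟩
  · have := hc 0; simp at this; omega
  · have := hc x; simp at this; split_ifs at this; omega
  have hx : x = 0 := hh x (by simp)
  subst hx
  have hmn : m < n := by have := (hW.mem m).1 (by simp); omega
  refine ⟨m, (0 :: m :: r).filter (· < m), (0 :: m :: r).filter (m < ·), hmn,
    ⟨⟨?_, hnc.sub List.filter_sublist, hav.sub List.filter_sublist⟩, ?_⟩,
    ⟨?_, hnc.sub List.filter_sublist, hav.sub List.filter_sublist⟩, ?_⟩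
  · intro v; rw [count_filter_lt, hc]; simp only [decide_eq_true_eq]; split_ifs <;> omega
  · rcases Nat.eq_zero_or_pos m with rfl | hm
    · simp
    · simp [hm]
  · intro v; rw [count_filter_lt, hc]; simp only [decide_eq_true_eq]; split_ifs <;> omega
  · rcases Nat.eq_zero_or_pos m with rfl | hm
    · have h0 : 0 ∉ r := by
        intro h
        have := hc 0
        have h1 := List.count_pos_iff.2 h
        simp at this; split_ifs at this <;> omega
      have : r.filter (0 < ·) = r := by
        rw [List.filter_eq_self]; intro x hx
        have : x ≠ 0 := fun h => h0 (h ▸ hx)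
        simp; omega
      simp [G]
      simpa using this
    · have c0 : r.count 0 = 1 := by
        have := hc 0
        rw [List.count_cons, List.count_cons] at this
        simp at this
        rw [if_neg (by omega), if_pos (by omega)] at this; omega
      have cm : r.count m = 1 := by
        have := hc m
        rw [List.count_cons, List.count_cons] at this
        simp at this
        rw [if_neg (by omega), if_pos (by omega)] at this; omega
      have m0 : 0 ∈ r := List.count_pos_iff.1 (by omega)
      have mm : m ∈ r := List.count_pos_iff.1 (by omega)
      rcases r with _ | ⟨x, r⟩
      · simp at m0
      have hxm : x = m := by
        by_contra hne
        have mm' : m ∈ r := by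
          rcases List.mem_cons.1 mm with h | h
          · exact absurd h.symm hne
          · exact h
        have hx0 : x ≠ 0 := by
          rintro rfl
          exact hnc 0 m (by omega) (by simpa using mm')
        have m0' : 0 ∈ r := by
          rcases List.mem_cons.1 m0 with h | h
          · exact absurd h.symm hx0
          · exact h
        rcases lt_or_gt_of_ne hne with h | h
        · obtain ⟨r1, r2, rfl⟩ := List.append_of_mem mm'
          rcases List.mem_append.1 m0' with h' | h'
          · apply hnc 0 m (by omega)
            simp only [List.cons_sublist_cons]
            apply List.Sublist.cons
            have e1 : [0] <+ r1 := by simpa using h'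
            have e2 : [m] <+ m :: r2 := by simp
            exact e1.append e2
          · have h'' : 0 ∈ r2 := by
              rcases List.mem_cons.1 h' with h | h
              · omega
              · exact h
            apply hav x m 0 (by omega) h
            apply List.Sublist.cons
            apply List.Sublist.cons
            simp only [List.cons_sublist_cons]
            exact Sublist.trans (by simpa using h'') (List.sublist_append_right r1 (m :: r2))
        · apply hav m x 0 hm h
          apply List.Sublist.cons
          simpa using m0'
      subst hxm
      have hnr : x ∉ r := by
        intro h
        have h1 := List.count_pos_iff.2 h
        simp at cm; omega
      have := split_filter x r hnr (fun y z h1 h2 h3 => hav x y z h1 h2 (by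
        apply List.Sublist.cons
        simp only [List.cons_sublist_cons]
        exact h3.cons _))
      simp [G, hm]
      exact this.symm

/-- The word of a function. -/
def wd {n : ℕ} (π : Fin (2 * n) → Fin n) : List ℕ := List.ofFn (fun i => (π i : ℕ))

theorem sub_finRange {N : ℕ} {l : List (Fin N)} : l <+ List.finRange N ↔ l.Pairwise (· < ·) := by
  constructor
  · intro h
    exact (List.sortedLT_finRange N).pairwise.sublist h
  · intro h
    apply List.sublist_of_subperm_of_sortedLE
    · have hnd : l.Nodup := h.imp (fun h => h.ne)
      exact hnd.subperm (fun x _ => List.mem_finRange x)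
    · exact (List.Pairwise.sortedLT h).sortedLE
    · exact (List.sortedLT_finRange N).sortedLE

theorem sub_wd {n : ℕ} (π : Fin (2 * n) → Fin n) (s : List ℕ) :
    s <+ wd π ↔ ∃ l : List (Fin (2 * n)), l.Pairwise (· < ·) ∧ s = l.map (fun i => (π i : ℕ)) := by
  rw [wd, List.ofFn_eq_map, List.sublist_map_iff]
  simp only [sub_finRange]

theorem NC_wd {n : ℕ} (π : Fin (2 * n) → Fin n) : NC (wd π) ↔ NonCrossing π := by
  constructor
  · rintro h ⟨i, j, k, l, h1, h2, h3, h4, h5, h6⟩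
    refine h (π i) (π j) (fun e => h6 (Fin.ext e)) ((sub_wd π _).2 ⟨[i, j, k, l], ?_, ?_⟩)
    · simp; omega
    · simp [← h4, ← h5]
  · intro h a b hab hs
    obtain ⟨l, hl, e⟩ := (sub_wd π _).1 hs
    rcases l with _ | ⟨i, _ | ⟨j, _ | ⟨k, _ | ⟨l, _ | ⟨_, _⟩⟩⟩⟩⟩ <;> simp at e
    simp at hl
    refine h ⟨i, j, k, l, by omega, by omega, by omega, Fin.ext (by omega), Fin.ext (by omega), ?_⟩
    intro e'
    rw [e'] at e
    omega

theorem AV_wd {n : ℕ} (π : Fin (2 * n) → Fin n) : AV (wd π) ↔ Avoids231 π := by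
  constructor
  · rintro h ⟨i, j, k, h1, h2, h3, h4⟩
    refine h (π i) (π j) (π k) h3 h4 ((sub_wd π _).2 ⟨[i, j, k], ?_, ?_⟩)
    · simp; omega
    · simp
  · intro h a b c hca hab hs
    obtain ⟨l, hl, e⟩ := (sub_wd π _).1 hs
    rcases l with _ | ⟨i, _ | ⟨j, _ | ⟨k, _ | ⟨_, _⟩⟩⟩⟩ <;> simp at e
    simp at hl
    exact h ⟨i, j, k, by omega, by omega, Fin.lt_def.2 (by omega), Fin.lt_def.2 (by omega)⟩

theorem count_wd {n : ℕ} (π : Fin (2 * n) → Fin n) (v : Fin n) :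
    (wd π).count (v : ℕ) = (Finset.univ.filter fun i => π i = v).card := by
  rw [wd, List.ofFn_eq_map, List.count, List.countP_map, List.countP_eq_length_filter,
    Finset.card_def, Finset.filter_val, Finset.val_univ_fin, Multiset.filter_coe, Multiset.coe_card]
  congr 1
  apply List.filter_congr
  intro i _
  by_cases hv : π i = v
  · simp [hv]
  · have : ¬ (π i : ℕ) = v := fun e => hv (Fin.ext e)
    simp [hv, this]

theorem W_wd {n : ℕ} (π : Fin (2 * n) → Fin n) :
    W 0 n (wd π) ↔ IsMultisetPerm π ∧ NonCrossing π ∧ Avoids231 π := by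
  rw [W, NC_wd, AV_wd]
  refine and_congr_left (fun _ => ?_)
  constructor
  · intro h v
    rw [← count_wd, h]; simp
  · intro h v
    by_cases hv : v < n
    · have := count_wd π ⟨v, hv⟩
      rw [h] at this
      simpa [hv] using this
    · rw [if_neg (by omega), List.count_eq_zero]
      intro hm
      simp only [wd, List.mem_ofFn] at hm
      obtain ⟨i, hi⟩ := hm
      omega

theorem wd_inj {n : ℕ} : Function.Injective (wd (n := n)) := by
  intro π π' h
  have := List.ofFn_injective h
  funext i
  exact Fin.ext (congrFun this i)

theorem W.length {a n : ℕ} {l : List ℕ} (h : W a n l) : l.length = 2 * n := by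
  have := Multiset.sum_count_eq_card (s := Finset.Ico a (a + n)) (m := (l : Multiset ℕ))
    (fun v hv => by simpa using (h.mem v).1 (by simpa using hv))
  rw [Multiset.coe_card] at this
  rw [← this]
  rw [Finset.sum_congr rfl (g := fun _ => 2)]
  · simp; omega
  · intro v hv
    rw [Multiset.coe_count, h.1, if_pos (by simpa using hv)]

theorem wd_surj {n : ℕ} {l : List ℕ} (h : W 0 n l) : ∃ π : Fin (2 * n) → Fin n, wd π = l := by
  have hl := h.length
  refine ⟨fun i => ⟨l[(i : ℕ)]'(by omega), ?_⟩, ?_⟩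
  · have := (h.mem _).1 (List.getElem_mem (l := l) (n := i) (by omega)); omega
  · apply List.ext_getElem
    · simp [wd, hl]
    · intro i h1 h2
      simp [wd]

theorem pbar_eq (n : ℕ) : pbar n = Nat.card {l // W 0 n l} := by
  refine Nat.card_eq_of_bijective (fun π => ⟨wd π.1, (W_wd _).2 π.2⟩) ⟨?_, ?_⟩
  · intro π π' h
    exact Subtype.ext (wd_inj (congrArg Subtype.val h))
  · rintro ⟨l, hl⟩
    obtain ⟨π, rfl⟩ := wd_surj hl
    exact ⟨⟨π, (W_wd _).1 hl⟩, rfl⟩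

theorem first_wd {n : ℕ} (hn : 1 ≤ n) (π : Fin (2 * n) → Fin n) :
    (∀ x ∈ (wd π).head?, x = 0) ↔ FirstIsOne π := by
  have : (wd π).head? = some (π ⟨0, by omega⟩ : ℕ) := by
    rw [List.head?_eq_getElem?, wd, List.getElem?_ofFn]
    simp; omega
  rw [this]
  simp only [Option.mem_def, Option.some.injEq, forall_eq', FirstIsOne]
  constructor
  · intro h
    exact ⟨hn, Fin.ext h⟩
  · rintro ⟨h, e⟩
    rw [e]

theorem qbar_eq (n : ℕ) (hn : 1 ≤ n) : qbar n = Nat.card {l // Q n l} := by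
  have key : ∀ π : Fin (2 * n) → Fin n, Q n (wd π) ↔
      IsMultisetPerm π ∧ NonCrossing π ∧ Avoids231 π ∧ FirstIsOne π := by
    intro π
    rw [Q, W_wd, first_wd hn]; tauto
  refine Nat.card_eq_of_bijective (fun π => ⟨wd π.1, (key _).2 π.2⟩) ⟨?_, ?_⟩
  · intro π π' h
    exact Subtype.ext (wd_inj (congrArg Subtype.val h))
  · rintro ⟨l, hl⟩
    obtain ⟨π, rfl⟩ := wd_surj hl.1
    exact ⟨⟨π, (key _).1 hl⟩, rfl⟩

theorem map_add_sub {a : ℕ} {s l : List ℕ} : s.map (· + a) <+ l.map (· + a) ↔ s <+ l := by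
  constructor
  · intro h
    have := h.map (· - a)
    simpa [List.map_map, Function.comp_def] using this
  · intro h; exact h.map _

theorem count_add (a v : ℕ) (l : List ℕ) : (l.map (· + a)).count (v + a) = l.count v :=
  List.count_map_of_injective l (· + a) (fun x y h => by simpa using h) v

theorem W_shift {a n : ℕ} {l : List ℕ} (h : W 0 n l) : W a n (l.map (· + a)) := by
  refine ⟨?_, ?_, ?_⟩
  · intro v
    by_cases hv : a ≤ v
    · obtain ⟨w, rfl⟩ := Nat.exists_eq_add_of_le' hv
      rw [count_add, h.1]
      split_ifs <;> omega
    · rw [if_neg (by omega), List.count_eq_zero]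
      intro hm
      obtain ⟨w, _, rfl⟩ := List.mem_map.1 hm
      omega
  · intro x y hxy hs
    obtain ⟨s, h1, h2⟩ := List.sublist_map_iff.1 hs
    rcases s with _ | ⟨i, _ | ⟨j, _ | ⟨k, _ | ⟨l, _ | ⟨_, _⟩⟩⟩⟩⟩ <;> simp at h2
    obtain rfl : k = i := by omega
    obtain rfl : l = j := by omega
    exact h.2.1 k l (by omega) h1
  · intro x y z hxy hyz hs
    obtain ⟨s, h1, h2⟩ := List.sublist_map_iff.1 hs
    rcases s with _ | ⟨i, _ | ⟨j, _ | ⟨k, _ | ⟨_, _⟩⟩⟩⟩ <;> simp at h2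
    exact h.2.2 i j k (by omega) (by omega) h1

theorem W_unshift {a n : ℕ} {l : List ℕ} (h : W a n (l.map (· + a))) : W 0 n l := by
  refine ⟨?_, ?_, ?_⟩
  · intro v
    have := h.1 (v + a)
    rw [count_add] at this
    rw [this]
    split_ifs <;> omega
  · intro x y hxy hs
    exact h.2.1 (x + a) (y + a) (by omega) (hs.map (· + a))
  · intro x y z hxy hyz hs
    exact h.2.2 (x + a) (y + a) (z + a) (by omega) (by omega) (hs.map (· + a))

theorem card_W (a n : ℕ) : Nat.card {l // W a n l} = pbar n := by
  rw [pbar_eq]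
  symm
  refine Nat.card_eq_of_bijective (fun l => ⟨l.1.map (· + a), W_shift l.2⟩) ⟨?_, ?_⟩
  · intro l l' h
    have h' := congrArg Subtype.val h
    exact Subtype.ext (List.map_injective_iff.2 (fun x y h => by simpa using h) h')
  · rintro ⟨l, hl⟩
    have e : (l.map (· - a)).map (· + a) = l := by
      rw [List.map_map]
      conv_rhs => rw [← List.map_id l]
      apply List.map_congr_left
      intro x hx
      have := (hl.mem x).1 hx
      simp; omega
    exact ⟨⟨l.map (· - a), W_unshift (a := a) (by rw [e]; exact hl)⟩, Subtype.ext e⟩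

instance finW0 (n : ℕ) : Finite {l // W 0 n l} :=
  Finite.of_injective (β := Fin (2 * n) → Fin n) (fun l => (wd_surj l.2).choose) (by
    intro l l' h
    have h1 := (wd_surj l.2).choose_spec
    have h2 := (wd_surj l'.2).choose_spec
    have h' : (wd_surj l.2).choose = (wd_surj l'.2).choose := h
    rw [h', h2] at h1
    exact Subtype.ext h1.symm)

instance finW (a n : ℕ) : Finite {l // W a n l} := by
  by_cases h : Nonempty {l // W a n l}
  · apply Nat.finite_of_card_ne_zero
    rw [card_W, pbar_eq, Nat.card_ne_zero]
    refine ⟨?_, finW0 n⟩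
    obtain ⟨l, hl⟩ := h
    have e : (l.map (· - a)).map (· + a) = l := by
      rw [List.map_map]
      conv_rhs => rw [← List.map_id l]
      apply List.map_congr_left
      intro x hx
      have := (hl.mem x).1 hx
      simp; omega
    exact ⟨⟨l.map (· - a), W_unshift (a := a) (by rw [e]; exact hl)⟩⟩
  · rw [not_nonempty_iff] at h
    infer_instance

instance finQ (n : ℕ) : Finite {l // Q n l} :=
  Finite.of_injective (β := {l // W 0 n l}) (fun l => ⟨l.1, l.2.1⟩) (by
    intro l l' h
    have h' : l.1 = l'.1 := by simpa using h
    exact Subtype.ext h')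

theorem Q_rec (n : ℕ) (hn : 1 ≤ n) : Nat.card {l // Q n l} =
    ∑ m : Fin n, Nat.card {l // Q m l} * pbar (n - m - 1) := by
  have : ∑ m : Fin n, Nat.card {l // Q m l} * pbar (n - m - 1) =
      Nat.card (Σ m : Fin n, {l // Q m l} × {l // W ((m : ℕ) + 1) (n - m - 1) l}) := by
    rw [Nat.card_sigma]
    simp only [Nat.card_prod, card_W]
  rw [this]
  symm
  refine Nat.card_eq_of_bijective (fun x => ⟨G x.1 x.2.1.1 x.2.2.1, ?_⟩) ⟨?_, ?_⟩
  · have := G_Q x.2.1.2 x.2.2.2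
    have e : (x.1 : ℕ) + 1 + (n - x.1 - 1) = n := by have := x.1.2; omega
    rwa [e] at this
  · rintro ⟨m, ⟨s, hs⟩, ⟨t, ht⟩⟩ ⟨m', ⟨s', hs'⟩, ⟨t', ht'⟩⟩ h
    have h : G m s t = G m' s' t' := congrArg Subtype.val h
    have em : m = m' := by
      apply Fin.ext
      rw [← G_get (t := t) hs, ← G_get (t := t') hs', h]
    subst em
    have es : s = s' := by rw [← G_lt hs ht, ← G_lt hs' ht', h]
    have et : t = t' := by rw [← G_gt hs ht, ← G_gt hs' ht', h]
    subst es et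
    rfl
  · rintro ⟨l, hl⟩
    obtain ⟨m, s, t, hm, hs, ht, e⟩ := G_surj hn hl
    exact ⟨⟨⟨m, hm⟩, ⟨s, hs⟩, ⟨t, ht⟩⟩, Subtype.ext e⟩

theorem Q_zero : Nat.card {l // Q 0 l} = 1 := by
  rw [Nat.card_eq_one_iff_unique]
  refine ⟨⟨?_⟩, ⟨⟨[], ⟨⟨?_, ?_, ?_⟩, ?_⟩⟩⟩⟩
  · rintro ⟨l, hl⟩ ⟨l', hl'⟩
    have h1 := hl.1.length
    have h2 := hl'.1.length
    simp at h1 h2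
    simp [h1, h2]
  · intro v; simp
  · intro a b _; simp
  · intro a b c _ _; simp
  · simp

/-- Sum over compositions. -/
noncomputable def C (n : ℕ) : ℕ :=
  ∑ c : Composition n, ((c.blocks.map fun x => pbar (x - 1)).prod)

/-- Prepend a block. -/
def cc {n : ℕ} (m : Fin n) (c : Composition m) : Composition n where
  blocks := (n - m) :: c.blocks
  blocks_pos := by
    intro i hi
    rcases List.mem_cons.1 hi with h | h
    · have := m.2; omega
    · exact c.blocks_pos h
  blocks_sum := by have := m.2; simp

theorem C_rec (n : ℕ) (hn : 1 ≤ n) : C n = ∑ m : Fin n, C m * pbar (n - m - 1) := by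
  simp only [C, Finset.sum_mul]
  rw [← Fintype.sum_sigma (α := fun m : Fin n => Composition m)
    (fun x => ((x.2.blocks.map fun x => pbar (x - 1)).prod) * pbar (n - x.1 - 1))]
  symm
  refine Fintype.sum_bijective (fun x : (Σ m : Fin n, Composition m) => cc x.1 x.2) ⟨?_, ?_⟩ _ _ ?_
  · rintro ⟨m, c⟩ ⟨m', c'⟩ h
    have h := congrArg Composition.blocks h
    simp only [cc, List.cons.injEq] at h
    have em : m = m' := by apply Fin.ext; have := m.2; have := m'.2; omega
    subst em
    have : c = c' := Composition.ext h.2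
    rw [this]
  · intro c
    obtain ⟨b, hp, hs⟩ := c
    rcases b with _ | ⟨x, b⟩
    · simp at hs; omega
    · have hx := hp (i := x) (by simp)
      simp only [List.sum_cons] at hs
      refine ⟨⟨⟨b.sum, by omega⟩, ⟨b, fun h => hp (List.mem_cons_of_mem _ h), rfl⟩⟩, ?_⟩
      apply Composition.ext
      simp only [cc, List.cons.injEq, and_true]
      omega
  · rintro ⟨m, c⟩
    simp [cc, mul_comm]

theorem C_zero : C 0 = 1 := by
  have : ∀ c : Composition 0, c.blocks = [] := by
    intro c
    by_contra h
    obtain ⟨x, b, e⟩ := List.exists_cons_of_ne_nil h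
    have h1 := c.blocks_pos (i := x) (by simp [e])
    have h2 := c.blocks_sum
    simp [e] at h2
    omega
  simp [C, this, composition_card]

theorem Q_eq_C (n : ℕ) : Nat.card {l // Q n l} = C n := by
  induction n using Nat.strong_induction_on with
  | _ n ih =>
    rcases Nat.eq_zero_or_pos n with rfl | hn
    · rw [Q_zero, C_zero]
    · rw [Q_rec n hn, C_rec n hn]
      exact Finset.sum_congr rfl (fun m _ => by rw [ih m m.2])

end NCW

theorem stmt11 (n : ℕ) (hn : 1 ≤ n) :
    qbar n = ∑ c : Composition n, ((c.blocks.map fun x => pbar (x - 1)).prod) := by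
  rw [NCW.qbar_eq n hn, NCW.Q_eq_C]
  rfl
end

section
/- For all n ≥ 1, the number of non-crossing permutations of {1,1,...,n,n} avoiding both the pattern 122 and the pattern 213 equals the Fibonacci number F_{n+1}, where F_1 = F_2 = 1. -/
/-- Avoiding 213: no i<j<k with π_j < π_i < π_k. -/
def Avoids213 {n : ℕ} (π : Fin (2*n) → Fin n) : Prop :=
  ¬ ∃ i j k : Fin (2*n), i < j ∧ j < k ∧ π j < π i ∧ π i < π k


/-- The words, encoded as functions on all naturals that vanish outside the word. -/
structure GoodWord (n : ℕ) (f : ℕ → ℕ) : Prop where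
  lt : ∀ i, i < 2 * n → f i < n
  out : ∀ i, 2 * n ≤ i → f i = 0
  occ : ∀ v, v < n → ∃ i j, i < j ∧ j < 2 * n ∧ f i = v ∧ f j = v ∧
    ∀ k, k < 2 * n → f k = v → k = i ∨ k = j
  nc : ∀ i j k l, i < j → j < k → k < l → l < 2 * n → f i = f k → f j = f l → f i = f j
  a122 : ∀ i j k, i < j → j < k → k < 2 * n → f i < f j → f j ≠ f k
  a213 : ∀ i j k, i < j → j < k → k < 2 * n → f j < f i → f k ≤ f i

/-- Prepend `n n`. -/
def addOne (n : ℕ) (f : ℕ → ℕ) : ℕ → ℕ := fun i => if i < 2 then n else f (i - 2)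

/-- Prepend `(n+1) n n (n+1)`. -/
def addTwo (n : ℕ) (f : ℕ → ℕ) : ℕ → ℕ := fun i =>
  if i = 0 ∨ i = 3 then n + 1 else if i < 4 then n else f (i - 4)

lemma addOne_good {n : ℕ} {f : ℕ → ℕ} (h : GoodWord n f) : GoodWord (n + 1) (addOne n f) := by
  obtain ⟨lt, out, occ, nc, a122, a213⟩ := h
  have e1 : ∀ i, i < 2 → addOne n f i = n := by intro i hi; simp [addOne, hi]
  have e2 : ∀ i, addOne n f (i + 2) = f i := by intro i; simp [addOne]
  have cs : ∀ i, i < 2 ∨ ∃ j, i = j + 2 := fun i => by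
    by_cases h : i < 2
    · exact Or.inl h
    · exact Or.inr ⟨i - 2, by omega⟩
  have lt2 : ∀ i, i < 2 * n → addOne n f (i + 2) < n := fun i hi => by rw [e2]; exact lt i hi
  refine ⟨?_, ?_, ?_, ?_, ?_, ?_⟩
  · intro i hi
    rcases cs i with h | ⟨j, rfl⟩
    · rw [e1 i h]; omega
    · have := lt2 j (by omega); omega
  · intro i hi
    rcases cs i with h | ⟨j, rfl⟩
    · omega
    · rw [e2]; exact out j (by omega)
  · intro v hv
    by_cases hvn : v = n
    · subst hvn
      refine ⟨0, 1, by omega, by omega, e1 _ (by omega), e1 _ (by omega), ?_⟩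
      intro k hk hfk
      rcases cs k with h | ⟨j, rfl⟩
      · omega
      · have := lt2 j (by omega); omega
    · obtain ⟨i, j, hij, hj, hi, hj', hu⟩ := occ v (by omega)
      refine ⟨i + 2, j + 2, by omega, by omega, by rw [e2, hi], by rw [e2, hj'], ?_⟩
      intro k hk hfk
      rcases cs k with h | ⟨m, rfl⟩
      · rw [e1 k h] at hfk; omega
      · rw [e2] at hfk
        have := hu m (by omega) hfk
        omega
  · intro i j k l h1 h2 h3 h4 h5 h6
    rcases cs l with h | ⟨l, rfl⟩
    · omega
    rcases cs k with h | ⟨k, rfl⟩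
    · omega
    have hl := lt2 l (by omega)
    have hk := lt2 k (by omega)
    rcases cs i with h | ⟨i, rfl⟩
    · rw [e1 i h] at h5; omega
    rcases cs j with h | ⟨j, rfl⟩
    · omega
    simp only [e2] at *
    exact nc i j k l (by omega) (by omega) (by omega) (by omega) h5 h6
  · intro i j k h1 h2 h3 h4 h5
    rcases cs k with h | ⟨k, rfl⟩
    · omega
    have hk := lt2 k (by omega)
    rcases cs j with h | ⟨j, rfl⟩
    · rw [e1 j h] at h5; omega
    have hj := lt2 j (by omega)
    rcases cs i with h | ⟨i, rfl⟩
    · rw [e1 i h] at h4; omega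
    simp only [e2] at *
    exact a122 i j k (by omega) (by omega) (by omega) h4 h5
  · intro i j k h1 h2 h3 h4
    rcases cs k with h | ⟨k, rfl⟩
    · omega
    have hk := lt2 k (by omega)
    rcases cs i with h | ⟨i, rfl⟩
    · rw [e1 i h]; omega
    rcases cs j with h | ⟨j, rfl⟩
    · omega
    simp only [e2] at *
    exact a213 i j k (by omega) (by omega) (by omega) h4

lemma addTwo_good {n : ℕ} {f : ℕ → ℕ} (h : GoodWord n f) : GoodWord (n + 2) (addTwo n f) := by
  obtain ⟨lt, out, occ, nc, a122, a213⟩ := h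
  have x0 : addTwo n f 0 = n + 1 := by simp [addTwo]
  have x1 : addTwo n f 1 = n := by simp [addTwo]
  have x2 : addTwo n f 2 = n := by simp [addTwo]
  have x3 : addTwo n f 3 = n + 1 := by simp [addTwo]
  have e2 : ∀ i, addTwo n f (i + 4) = f i := by intro i; simp [addTwo]
  have cs : ∀ i, (i = 0 ∨ i = 1 ∨ i = 2 ∨ i = 3) ∨ ∃ j, i = j + 4 := fun i => by
    by_cases h : i < 4
    · left; omega
    · exact Or.inr ⟨i - 4, by omega⟩
  have lt2 : ∀ i, i < 2 * n → addTwo n f (i + 4) < n := fun i hi => by rw [e2]; exact lt i hi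
  have ge : ∀ i, i < 4 → n ≤ addTwo n f i := fun i hi => by
    interval_cases i <;> omega
  have le : ∀ i, i < 2 * (n + 2) → addTwo n f i < n + 2 := fun i hi => by
    rcases cs i with (rfl | rfl | rfl | rfl) | ⟨j, rfl⟩
    any_goals omega
    have := lt2 j (by omega); omega
  refine ⟨le, ?_, ?_, ?_, ?_, ?_⟩
  · intro i hi
    rcases cs i with h | ⟨j, rfl⟩
    · omega
    · rw [e2]; exact out j (by omega)
  · intro v hv
    by_cases hvn : v = n
    · subst hvn
      refine ⟨1, 2, by omega, by omega, x1, x2, ?_⟩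
      intro k hk hfk
      rcases cs k with (rfl | rfl | rfl | rfl) | ⟨j, rfl⟩
      any_goals omega
      have := lt2 j (by omega); omega
    by_cases hvn : v = n + 1
    · subst hvn
      refine ⟨0, 3, by omega, by omega, x0, x3, ?_⟩
      intro k hk hfk
      rcases cs k with (rfl | rfl | rfl | rfl) | ⟨j, rfl⟩
      any_goals omega
      have := lt2 j (by omega); omega
    · obtain ⟨i, j, hij, hj, hi, hj', hu⟩ := occ v (by omega)
      refine ⟨i + 4, j + 4, by omega, by omega, by rw [e2, hi], by rw [e2, hj'], ?_⟩
      intro k hk hfk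
      rcases cs k with h | ⟨m, rfl⟩
      · have := ge k (by omega); omega
      · rw [e2] at hfk
        have := hu m (by omega) hfk
        omega
  · intro i j k l h1 h2 h3 h4 h5 h6
    rcases cs l with h | ⟨l, rfl⟩
    · obtain ⟨rfl, rfl, rfl, rfl⟩ : i = 0 ∧ j = 1 ∧ k = 2 ∧ l = 3 := by omega
      omega
    have hl := lt2 l (by omega)
    rcases cs j with h | ⟨j, rfl⟩
    · have := ge j (by omega); omega
    rcases cs k with h | ⟨k, rfl⟩
    · omega
    have hk := lt2 k (by omega)
    rcases cs i with h | ⟨i, rfl⟩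
    · have := ge i (by omega); omega
    simp only [e2] at *
    exact nc i j k l (by omega) (by omega) (by omega) (by omega) h5 h6
  · intro i j k h1 h2 h3 h4 h5
    rcases cs k with h | ⟨k, rfl⟩
    · have hj : j = 1 ∨ j = 2 := by omega
      rcases hj with rfl | rfl
      · have := ge i (by omega); omega
      · have := ge i (by omega); omega
    have hk := lt2 k (by omega)
    rcases cs j with h | ⟨j, rfl⟩
    · have := ge j (by omega); omega
    rcases cs i with h | ⟨i, rfl⟩
    · have := ge i (by omega); omega
    simp only [e2] at *
    exact a122 i j k (by omega) (by omega) (by omega) h4 h5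
  · intro i j k h1 h2 h3 h4
    rcases cs k with h | ⟨k, rfl⟩
    · have := ge j (by omega)
      have := le i (by omega)
      have := le k (by omega)
      omega
    have hk := lt2 k (by omega)
    rcases cs i with h | ⟨i, rfl⟩
    · have := ge i (by omega); omega
    rcases cs j with h | ⟨j, rfl⟩
    · omega
    simp only [e2] at *
    exact a213 i j k (by omega) (by omega) (by omega) h4

/-- Removing a prefix that consists of all the copies of the large values. -/
lemma shift_good {n m : ℕ} {f : ℕ → ℕ} (h : GoodWord (n + m) f)
    (hp : ∀ i, i < 2 * m → n ≤ f i) (hs : ∀ i, i < 2 * n → f (i + 2 * m) < n) :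
    GoodWord n (fun i => f (i + 2 * m)) := by
  obtain ⟨lt, out, occ, nc, a122, a213⟩ := h
  refine ⟨hs, fun i hi => out _ (by omega), ?_, ?_, ?_, ?_⟩
  · intro v hv
    obtain ⟨i, j, hij, hj, hi, hj', hu⟩ := occ v (by omega)
    have hi2 : 2 * m ≤ i := by
      by_contra hc
      have := hp i (by omega); omega
    refine ⟨i - 2 * m, j - 2 * m, by omega, by omega, ?_, ?_, ?_⟩
    · show f (i - 2 * m + 2 * m) = v
      rw [Nat.sub_add_cancel hi2, hi]
    · show f (j - 2 * m + 2 * m) = v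
      rw [Nat.sub_add_cancel (by omega), hj']
    · intro k hk hfk
      have := hu (k + 2 * m) (by omega) hfk
      omega
  · intro i j k l h1 h2 h3 h4 h5 h6
    exact nc _ _ _ _ (by omega) (by omega) (by omega) (by omega) h5 h6
  · intro i j k h1 h2 h3 h4
    exact a122 _ _ _ (by omega) (by omega) (by omega) h4
  · intro i j k h1 h2 h3 h4
    exact a213 _ _ _ (by omega) (by omega) (by omega) h4

lemma occ_unique {n : ℕ} {f : ℕ → ℕ} (h : GoodWord n f) {v a b c : ℕ} (hab : a < b)
    (hb : b < 2 * n) (ha' : f a = v) (hb' : f b = v) (hc : c < 2 * n) (hc' : f c = v) :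
    c = a ∨ c = b := by
  obtain ⟨i, j, hij, hj, hi, hj', hu⟩ := h.occ v (by have := h.lt b hb; omega)
  have := hu a (by omega) ha'
  have := hu b (by omega) hb'
  have := hu c (by omega) hc'
  omega

lemma first_max {n : ℕ} {f : ℕ → ℕ} (h : GoodWord (n + 1) f) : f 0 = n := by
  obtain ⟨i, j, hij, hj, hi, hj', hu⟩ := h.occ n (by omega)
  by_contra hne
  have h0 := h.lt 0 (by omega)
  have hi0 : 0 < i := by
    rcases Nat.eq_zero_or_pos i with rfl | h
    · omega
    · exact h
  exact h.a122 0 i j hi0 hij hj (by omega) (by omega)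

lemma eq_addOne {n : ℕ} {f : ℕ → ℕ} (h : GoodWord (n + 1) f) (h1 : f 1 = n) :
    ∃ g, GoodWord n g ∧ addOne n g = f := by
  have h0 := first_max h
  refine ⟨fun i => f (i + 2 * 1), shift_good h ?_ ?_, ?_⟩
  · intro i hi
    interval_cases i <;> omega
  · intro i hi
    have := h.lt (i + 2 * 1) (by omega)
    by_contra hc
    have := occ_unique h (v := n) (a := 0) (b := 1) (c := i + 2 * 1)
      (by omega) (by omega) h0 h1 (by omega) (by omega)
    omega
  · funext i
    unfold addOne
    split_ifs with hi
    · interval_cases i <;> omega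
    · show f (i - 2 + 2 * 1) = f i
      congr 1; omega

lemma eq_addTwo {n : ℕ} {f : ℕ → ℕ} (h : GoodWord (n + 2) f) (h1 : f 1 ≠ n + 1) :
    ∃ g, GoodWord n g ∧ addTwo n g = f := by
  have h0 : f 0 = n + 1 := first_max (n := n + 1) h
  have hlt1 := h.lt 1 (by omega)
  obtain ⟨i, j, hij, hj, hi, hj', hu⟩ := h.occ n (by omega)
  have hi1 : i = 1 := by
    by_contra hne
    have hi0 : i ≠ 0 := by rintro rfl; omega
    have : f 1 ≠ n := by
      intro hc
      have := hu 1 (by omega) hc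
      omega
    exact h.a122 1 i j (by omega) hij hj (by omega) (by omega)
  subst hi1
  obtain ⟨a, b, hab, hb, ha, hb', hu'⟩ := h.occ (n + 1) (by omega)
  have ha0 : a = 0 := by
    have := hu' 0 (by omega) h0
    omega
  subst ha0
  have hb1 : b ≠ 1 := by rintro rfl; omega
  have hbj : b ≠ j := by rintro rfl; omega
  have hjb : j < b := by
    by_contra hc
    have := h.nc 0 1 b j (by omega) (by omega) (by omega) hj (by omega) (by omega)
    omega
  have key : ∀ k, 1 < k → k < b → k = j := by
    intro k hk1 hkb
    by_contra hc
    have hl := h.lt k (by omega)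
    have : f k ≠ n := by
      intro hh
      have := hu k (by omega) hh
      omega
    have : f k ≠ n + 1 := by
      intro hh
      have := hu' k (by omega) hh
      omega
    have := h.a213 1 k b hk1 hkb hb (by omega)
    omega
  have hj2 : j = 2 := by
    have := key 2 (by omega) (by omega)
    omega
  subst hj2
  have hb3 : b = 3 := by
    by_contra hc
    have := key 3 (by omega) (by omega)
    omega
  subst hb3
  refine ⟨fun i => f (i + 2 * 2), shift_good h ?_ ?_, ?_⟩
  · intro i hi
    interval_cases i <;> omega
  · intro i hi
    have := h.lt (i + 2 * 2) (by omega)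
    have : f (i + 2 * 2) ≠ n := by
      intro hh
      have := hu _ (by omega) hh
      omega
    have : f (i + 2 * 2) ≠ n + 1 := by
      intro hh
      have := hu' _ (by omega) hh
      omega
    omega
  · funext i
    unfold addTwo
    split_ifs with hi hi2
    · rcases hi with rfl | rfl <;> omega
    · obtain rfl | rfl : i = 1 ∨ i = 2 := by omega
      all_goals omega
    · show f (i - 4 + 2 * 2) = f i
      congr 1; omega

lemma addOne_inj (n : ℕ) : Function.Injective (addOne n) := by
  intro f g h
  funext i
  have := congrFun h (i + 2)
  simpa [addOne] using this

lemma addTwo_inj (n : ℕ) : Function.Injective (addTwo n) := by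
  intro f g h
  funext i
  have := congrFun h (i + 4)
  simpa [addTwo] using this

lemma good_zero : {f | GoodWord 0 f} = {fun _ => 0} := by
  ext f
  simp only [Set.mem_ofPred_eq, Set.mem_singleton_iff]
  constructor
  · intro h
    funext i
    exact h.out i (by omega)
  · rintro rfl
    refine ⟨?_, ?_, ?_, ?_, ?_, ?_⟩ <;> intros <;> first | rfl | omega

lemma good_one : {f | GoodWord 1 f} = addOne 0 '' {f | GoodWord 0 f} := by
  ext f
  constructor
  · intro h
    have := h.lt 1 (by omega)
    exact eq_addOne (n := 0) h (by omega)
  · rintro ⟨g, hg, rfl⟩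
    exact addOne_good hg

lemma good_step (n : ℕ) : {f | GoodWord (n + 2) f} =
    addOne (n + 1) '' {f | GoodWord (n + 1) f} ∪ addTwo n '' {f | GoodWord n f} := by
  ext f
  constructor
  · intro h
    by_cases h1 : f 1 = n + 1
    · exact Or.inl (eq_addOne (n := n + 1) h h1)
    · exact Or.inr (eq_addTwo h h1)
  · rintro (⟨g, hg, rfl⟩ | ⟨g, hg, rfl⟩)
    · exact addOne_good hg
    · exact addTwo_good hg

lemma good_card (n : ℕ) :
    {f | GoodWord n f}.Finite ∧ {f | GoodWord n f}.ncard = Nat.fib (n + 1) := by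
  induction n using Nat.twoStepInduction with
  | zero => rw [good_zero]; simp
  | one =>
    rw [good_one, good_zero]; simp
  | more n ih0 ih1 =>
    rw [good_step]
    refine ⟨(ih1.1.image _).union (ih0.1.image _), ?_⟩
    rw [Set.ncard_union_eq ?_ (ih1.1.image _) (ih0.1.image _),
      Set.ncard_image_of_injective _ (addOne_inj _), Set.ncard_image_of_injective _ (addTwo_inj _),
      ih0.2, ih1.2, Nat.fib_add_two (n := n + 1)]
    · exact Nat.add_comm _ _
    · rw [Set.disjoint_left]
      rintro _ ⟨g, -, rfl⟩ ⟨g', -, h⟩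
      have := congrFun h 1
      simp [addOne, addTwo] at this

/-- Extension of a word by zero. -/
def extendWord {n : ℕ} (π : Fin (2 * n) → Fin n) : ℕ → ℕ :=
  fun i => if h : i < 2 * n then (π ⟨i, h⟩ : ℕ) else 0

lemma extendWord_fin {n : ℕ} (π : Fin (2 * n) → Fin n) (i : Fin (2 * n)) :
    extendWord π i = π i := by
  simp [extendWord]

lemma multiset_iff {n : ℕ} (π : Fin (2 * n) → Fin n) : IsMultisetPerm π ↔
    ∀ v : Fin n, ∃ i j, i < j ∧ π i = v ∧ π j = v ∧ ∀ k, π k = v → k = i ∨ k = j := by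
  refine forall_congr' fun v => ?_
  rw [Finset.card_eq_two]
  constructor
  · rintro ⟨x, y, hxy, h⟩
    have hm : ∀ k, π k = v ↔ k = x ∨ k = y := fun k => by
      have := Finset.ext_iff.1 h k
      simpa using this
    rcases lt_or_gt_of_ne hxy with hl | hl
    · exact ⟨x, y, hl, (hm x).2 (Or.inl rfl), (hm y).2 (Or.inr rfl), fun k hk => (hm k).1 hk⟩
    · exact ⟨y, x, hl, (hm y).2 (Or.inr rfl), (hm x).2 (Or.inl rfl),
        fun k hk => ((hm k).1 hk).symm⟩
  · rintro ⟨i, j, hij, hi, hj, hu⟩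
    refine ⟨i, j, hij.ne, ?_⟩
    ext k
    simp only [Finset.mem_filter, Finset.mem_univ, true_and, Finset.mem_insert,
      Finset.mem_singleton]
    exact ⟨hu k, by rintro (rfl | rfl) <;> assumption⟩

lemma extend_good_iff {n : ℕ} (π : Fin (2 * n) → Fin n) :
    (IsMultisetPerm π ∧ NonCrossing π ∧ Avoids122 π ∧ Avoids213 π) ↔
      GoodWord n (extendWord π) := by
  have e : ∀ i (h : i < 2 * n), extendWord π i = π ⟨i, h⟩ := fun i h => extendWord_fin π ⟨i, h⟩
  rw [multiset_iff]
  constructor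
  · rintro ⟨hm, hn, h1, h2⟩
    refine ⟨?_, ?_, ?_, ?_, ?_, ?_⟩
    · intro i hi
      rw [e i hi]; exact (π _).2
    · intro i hi
      simp [extendWord, Nat.not_lt.2 hi]
    · intro v hv
      obtain ⟨i, j, hij, hi, hj, hu⟩ := hm ⟨v, hv⟩
      refine ⟨i, j, hij, j.2, by rw [extendWord_fin, hi], by rw [extendWord_fin, hj], ?_⟩
      intro k hk hfk
      rw [e k hk] at hfk
      rcases hu ⟨k, hk⟩ (Fin.ext hfk) with h | h
      · exact Or.inl (congrArg Fin.val h)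
      · exact Or.inr (congrArg Fin.val h)
    · intro i j k l hij hjk hkl hl h3 h4
      rw [e i (by omega), e k (by omega)] at h3
      rw [e j (by omega), e l (by omega)] at h4
      rw [e i (by omega), e j (by omega)]
      by_contra hc
      exact hn ⟨⟨i, by omega⟩, ⟨j, by omega⟩, ⟨k, by omega⟩, ⟨l, hl⟩, hij, hjk, hkl,
        Fin.ext h3, Fin.ext h4, fun hh => hc (congrArg Fin.val hh)⟩
    · intro i j k hij hjk hk h3 h4
      rw [e i (by omega), e j (by omega)] at h3
      rw [e j (by omega), e k (by omega)] at h4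
      exact h1 ⟨⟨i, by omega⟩, ⟨j, by omega⟩, ⟨k, by omega⟩, hij, hjk, h3, Fin.ext h4⟩
    · intro i j k hij hjk hk h3
      rw [e i (by omega), e j (by omega)] at h3
      rw [e i (by omega), e k (by omega)]
      by_contra hc
      exact h2 ⟨⟨i, by omega⟩, ⟨j, by omega⟩, ⟨k, by omega⟩, hij, hjk, h3, Nat.lt_of_not_le hc⟩
  · intro h
    refine ⟨?_, ?_, ?_, ?_⟩
    · intro v
      obtain ⟨i, j, hij, hj, hi, hj', hu⟩ := h.occ v v.2
      rw [e i (by omega)] at hi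
      rw [e j (by omega)] at hj'
      refine ⟨⟨i, by omega⟩, ⟨j, hj⟩, hij, Fin.ext hi, Fin.ext hj', ?_⟩
      intro k hk
      rcases hu k k.2 (by rw [extendWord_fin, hk]) with h | h
      · exact Or.inl (Fin.ext h)
      · exact Or.inr (Fin.ext h)
    · rintro ⟨i, j, k, l, hij, hjk, hkl, h3, h4, h5⟩
      refine h5 (Fin.ext ?_)
      have := h.nc i j k l hij hjk hkl l.2 (by simp only [extendWord_fin, h3])
        (by simp only [extendWord_fin, h4])
      simpa only [extendWord_fin] using this
    · rintro ⟨i, j, k, hij, hjk, h3, h4⟩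
      exact h.a122 i j k hij hjk k.2 (by simp only [extendWord_fin]; exact h3)
        (by simp only [extendWord_fin, h4])
    · rintro ⟨i, j, k, hij, hjk, h3, h4⟩
      have := h.a213 i j k hij hjk k.2 (by simp only [extendWord_fin]; exact h3)
      simp only [extendWord_fin] at this
      exact absurd h4 (not_lt.2 this)

theorem stmt14 (n : ℕ) (hn : 1 ≤ n) :
    Nat.card {π : Fin (2*n) → Fin n //
      IsMultisetPerm π ∧ NonCrossing π ∧ Avoids122 π ∧ Avoids213 π} =
      Nat.fib (n+1) := by
  rw [← (good_card n).2, ← Nat.card_coe_set_eq]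
  refine Nat.card_eq_of_bijective
    (fun π => (⟨extendWord π.1, (extend_good_iff π.1).1 π.2⟩ : {f | GoodWord n f})) ⟨?_, ?_⟩
  · intro π σ h
    have h' : extendWord π.1 = extendWord σ.1 := congrArg Subtype.val h
    apply Subtype.ext
    funext i
    apply Fin.ext
    rw [← extendWord_fin, ← extendWord_fin, h']
  · rintro ⟨f, hf⟩
    have hf' : GoodWord n f := hf
    have he : extendWord (fun i : Fin (2 * n) => (⟨f i, hf'.lt i i.2⟩ : Fin n)) = f := by
      funext i
      unfold extendWord
      split_ifs with hi
      · rfl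
      · exact (hf'.out i (by omega)).symm
    exact ⟨⟨_, (extend_good_iff _).2 (he.symm ▸ hf')⟩, Subtype.ext he⟩
end
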